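/- There exists a constant C > 0, depending only on T, α, β, K and δ, such that for every classical solution (v,u,θ,w,b) of the planar compressible MHD system on ℝ × [0,T] with (K,δ)-admissible initial data, one has ∫₀^T sup_{x∈ℝ} |b(x,t)|² dt ≤ C. -/

import Mathlib

open MeasureTheory Set Filter

noncomputable section

/-- Viscosity function `μ(z) = 1 + α z^(−α)` (here `μ̃₁ = 1`, `μ̃₂ = α`). -/
def visc (α z : ℝ) : ℝ := 1 + α * z ^ (-α)

/-- Squared Euclidean norm on `ℝ × ℝ` (used for the transverse fields `w, b ∈ ℝ²`). -/
def sq2 (p : ℝ × ℝ) : ℝ := p.1 ^ 2 + p.2 ^ 2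

/-- Partial derivative with respect to the first (spatial) variable. -/
def pdx {E : Type*} [NormedAddCommGroup E] [NormedSpace ℝ E]
    (f : ℝ → ℝ → E) (x t : ℝ) : E := deriv (fun y => f y t) x

/-- Partial derivative with respect to the second (time) variable, taken within `[0, T]`
(so it is one-sided at the endpoints). -/
def pdt (T : ℝ) {E : Type*} [NormedAddCommGroup E] [NormedSpace ℝ E]
    (f : ℝ → ℝ → E) (x t : ℝ) : E := derivWithin (fun s => f x s) (Icc 0 T) t

/-- A classical solution of the planar compressible MHD system (in Lagrangian coordinates,
with all physical constants normalized to `1` and `μ̃₂ = α`) on `ℝ × [0,T]`: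
all the derivatives appearing in the equations exist and are continuous, `v, θ > 0`,
the five equations hold pointwise, the solution tends to `(1,0,1,0,0)` as `|x| → ∞`
uniformly in `t ∈ [0,T]`, and `v−1, u, θ−1, b, w` and their first spatial derivatives
are square-integrable in `x` for each `t ∈ [0,T]`. -/
structure IsClassicalSolution (α β T : ℝ) (v u θ : ℝ → ℝ → ℝ)
    (w b : ℝ → ℝ → ℝ × ℝ) : Prop where
  v_pos : ∀ x : ℝ, ∀ t ∈ Icc (0:ℝ) T, 0 < v x t
  θ_pos : ∀ x : ℝ, ∀ t ∈ Icc (0:ℝ) T, 0 < θ x t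
  diff_x : ∀ x : ℝ, ∀ t ∈ Icc (0:ℝ) T,
    DifferentiableAt ℝ (fun y => v y t) x ∧ DifferentiableAt ℝ (fun y => u y t) x ∧
    DifferentiableAt ℝ (fun y => θ y t) x ∧ DifferentiableAt ℝ (fun y => w y t) x ∧
    DifferentiableAt ℝ (fun y => b y t) x
  diff_xx : ∀ x : ℝ, ∀ t ∈ Icc (0:ℝ) T,
    DifferentiableAt ℝ (fun y => pdx u y t) x ∧ DifferentiableAt ℝ (fun y => pdx θ y t) x ∧
    DifferentiableAt ℝ (fun y => pdx w y t) x ∧ DifferentiableAt ℝ (fun y => pdx b y t) x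
  diff_t : ∀ x : ℝ, ∀ t ∈ Icc (0:ℝ) T,
    DifferentiableWithinAt ℝ (fun s => v x s) (Icc 0 T) t ∧
    DifferentiableWithinAt ℝ (fun s => u x s) (Icc 0 T) t ∧
    DifferentiableWithinAt ℝ (fun s => θ x s) (Icc 0 T) t ∧
    DifferentiableWithinAt ℝ (fun s => w x s) (Icc 0 T) t ∧
    DifferentiableWithinAt ℝ (fun s => b x s) (Icc 0 T) t
  cont : ContinuousOn (fun p : ℝ × ℝ =>
      (v p.1 p.2, u p.1 p.2, θ p.1 p.2, w p.1 p.2, b p.1 p.2)) (univ ×ˢ Icc 0 T)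
  cont_dx : ContinuousOn (fun p : ℝ × ℝ =>
      (pdx v p.1 p.2, pdx u p.1 p.2, pdx θ p.1 p.2, pdx w p.1 p.2, pdx b p.1 p.2))
      (univ ×ˢ Icc 0 T)
  cont_dxx : ContinuousOn (fun p : ℝ × ℝ =>
      (pdx (pdx u) p.1 p.2, pdx (pdx θ) p.1 p.2, pdx (pdx w) p.1 p.2, pdx (pdx b) p.1 p.2))
      (univ ×ˢ Icc 0 T)
  cont_dt : ContinuousOn (fun p : ℝ × ℝ =>
      (pdt T v p.1 p.2, pdt T u p.1 p.2, pdt T θ p.1 p.2, pdt T w p.1 p.2, pdt T b p.1 p.2))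
      (univ ×ˢ Icc 0 T)
  eq_mass : ∀ x : ℝ, ∀ t ∈ Icc (0:ℝ) T, pdt T v x t = pdx u x t
  eq_mom : ∀ x : ℝ, ∀ t ∈ Icc (0:ℝ) T,
    pdt T u x t + pdx (fun y s => θ y s / v y s + sq2 (b y s) / 2) x t
      = pdx (fun y s => visc α (v y s) * pdx u y s / v y s) x t
  eq_w : ∀ x : ℝ, ∀ t ∈ Icc (0:ℝ) T,
    pdt T w x t - pdx b x t = pdx (fun y s => (v y s)⁻¹ • pdx w y s) x t
  eq_b : ∀ x : ℝ, ∀ t ∈ Icc (0:ℝ) T,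
    pdt T (fun y s => v y s • b y s) x t - pdx w x t
      = pdx (fun y s => (v y s)⁻¹ • pdx b y s) x t
  eq_temp : ∀ x : ℝ, ∀ t ∈ Icc (0:ℝ) T,
    pdt T θ x t + θ x t / v x t * pdx u x t
      = pdx (fun y s => θ y s ^ β * pdx θ y s / v y s) x t
        + (visc α (v x t) * pdx u x t ^ 2 + sq2 (pdx w x t) + sq2 (pdx b x t)) / v x t
  farfield : ∀ ε > (0:ℝ), ∃ M : ℝ, ∀ x : ℝ, ∀ t ∈ Icc (0:ℝ) T, M ≤ |x| →
    |v x t - 1| < ε ∧ |u x t| < ε ∧ |θ x t - 1| < ε ∧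
    Real.sqrt (sq2 (b x t)) < ε ∧ Real.sqrt (sq2 (w x t)) < ε
  sq_int : ∀ t ∈ Icc (0:ℝ) T,
    Integrable (fun x => (v x t - 1) ^ 2) ∧ Integrable (fun x => (u x t) ^ 2) ∧
    Integrable (fun x => (θ x t - 1) ^ 2) ∧ Integrable (fun x => sq2 (b x t)) ∧
    Integrable (fun x => sq2 (w x t)) ∧
    Integrable (fun x => (pdx v x t) ^ 2) ∧ Integrable (fun x => (pdx u x t) ^ 2) ∧
    Integrable (fun x => (pdx θ x t) ^ 2) ∧ Integrable (fun x => sq2 (pdx b x t)) ∧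
    Integrable (fun x => sq2 (pdx w x t))

/-- The initial data of a solution are `(K, δ)`-admissible: the `H¹`-type norm of
`(v₀−1, u₀, θ₀−1, b₀, w₀)` is at most `K²` and `v₀ ≥ δ`, `θ₀ ≥ δ`. -/
def Admissible (K δ : ℝ) (v u θ : ℝ → ℝ → ℝ) (w b : ℝ → ℝ → ℝ × ℝ) : Prop :=
  (∫ x : ℝ, ((v x 0 - 1) ^ 2 + (u x 0) ^ 2 + (θ x 0 - 1) ^ 2 + sq2 (b x 0) + sq2 (w x 0)
      + (pdx v x 0) ^ 2 + (pdx u x 0) ^ 2 + (pdx θ x 0) ^ 2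
      + sq2 (pdx b x 0) + sq2 (pdx w x 0))) ≤ K ^ 2 ∧
  (∀ x : ℝ, δ ≤ v x 0) ∧ (∀ x : ℝ, δ ≤ θ x 0)

/-! ### Elementary inequalities and integration lemmas -/

theorem integral_swap_of_continuous {f : ℝ → ℝ → ℝ}
    (hf : Continuous fun p : ℝ × ℝ => f p.1 p.2) (a b c d : ℝ) :
    ∫ x in a..b, ∫ s in c..d, f x s = ∫ s in c..d, ∫ x in a..b, f x s := by
  apply intervalIntegral_intervalIntegral_swap
  have h : IntegrableOn (fun p : ℝ × ℝ => f p.1 p.2) (uIcc a b ×ˢ uIcc c d) :=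
    hf.continuousOn.integrableOn_compact (isCompact_uIcc.prod isCompact_uIcc)
  exact h.mono_set (prod_mono uIoc_subset_uIcc uIoc_subset_uIcc)

theorem continuous_intervalIntegral_left {f : ℝ → ℝ → ℝ}
    (hf : Continuous fun p : ℝ × ℝ => f p.1 p.2) (a b : ℝ) :
    Continuous fun s => ∫ x in a..b, f x s :=
  intervalIntegral.continuous_parametric_intervalIntegral_of_continuous'
    (f := fun s x => f x s) (hf.comp continuous_swap) a b

/-- Weighted spatial integrals evolve by the integral of the time derivative. -/
theorem integral_mul_sub_eq_integral_integral {f ft : ℝ → ℝ → ℝ} {ψ : ℝ → ℝ} {T t : ℝ}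
    (hf : Continuous fun p : ℝ × ℝ => f p.1 p.2) (hft : Continuous fun p : ℝ × ℝ => ft p.1 p.2)
    (hψ : Continuous ψ)
    (hd : ∀ x, ∀ s ∈ Ioo 0 T, HasDerivAt (fun s => f x s) (ft x s) s) (ht : t ∈ Icc 0 T)
    (a b : ℝ) :
    (∫ x in a..b, ψ x * f x t) - (∫ x in a..b, ψ x * f x 0)
      = ∫ s in (0:ℝ)..t, ∫ x in a..b, ψ x * ft x s := by
  have hc : ∀ s, Continuous fun x => f x s := fun s =>
    hf.comp (by fun_prop : Continuous fun x => (x, s))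
  have hc' : ∀ x, Continuous fun s => f x s := fun x =>
    hf.comp (by fun_prop : Continuous fun s => (x, s))
  have hc'' : ∀ x, Continuous fun s => ft x s := fun x =>
    hft.comp (by fun_prop : Continuous fun s => (x, s))
  rw [← integral_swap_of_continuous (f := fun x s => ψ x * ft x s)
    ((hψ.comp continuous_fst).mul hft),
    ← intervalIntegral.integral_sub ((hψ.fun_mul (hc t)).intervalIntegrable _ _)
    ((hψ.fun_mul (hc 0)).intervalIntegrable _ _)]
  congr 1
  ext x
  rw [intervalIntegral.integral_const_mul, intervalIntegral.integral_eq_sub_of_hasDerivAt_of_le ht.1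
    (hc' x).continuousOn (fun s hs => hd x s ⟨hs.1, hs.2.trans_le ht.2⟩)
    ((hc'' x).intervalIntegrable _ _)]
  ring

theorem exists_le_of_integral_le {f : ℝ → ℝ} (hf : Continuous f) {x C : ℝ}
    (h : ∫ y in x..(x + 1), f y ≤ C) : ∃ y ∈ Icc x (x + 1), f y ≤ C := by
  by_contra! hcon
  have : ∫ y in x..(x + 1), C < ∫ y in x..(x + 1), f y :=
    intervalIntegral.integral_lt_integral_of_continuousOn_of_le_of_exists_lt (by linarith)
      continuousOn_const hf.continuousOn (fun y hy => (hcon y ⟨hy.1.le, hy.2⟩).le)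
      ⟨x, ⟨le_rfl, by linarith⟩, hcon x ⟨le_rfl, by linarith⟩⟩
  simp at this
  linarith

theorem integral_le_of_subinterval {f : ℝ → ℝ} (hf : Continuous f) (h0 : ∀ x, 0 ≤ f x)
    {a b c d : ℝ} (hca : c ≤ a) (hab : a ≤ b) (hbd : b ≤ d) :
    ∫ x in a..b, f x ≤ ∫ x in c..d, f x :=
  intervalIntegral.integral_mono_interval hca hab hbd (Eventually.of_forall h0)
    (hf.intervalIntegrable _ _)

theorem sq_le_mul_of_forall_two_mul_le {a X Y : ℝ} (ha : 0 < a) (hY : 0 < Y)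
    (h : ∀ l > 0, 2 * a ≤ l * X + Y / l) : a ^ 2 ≤ X * Y := by
  have := h (Y / a) (by positivity)
  rw [div_div_cancel₀ hY.ne'] at this
  have h2 : a ≤ Y / a * X := by linarith
  rw [div_mul_eq_mul_div, le_div_iff₀ ha] at h2
  nlinarith

theorem sub_log_sub_one_nonneg {y : ℝ} (hy : 0 < y) : 0 ≤ y - Real.log y - 1 := by
  linarith [Real.log_le_sub_one_of_pos hy]

theorem le_two_mul_sub_log_add_two {y : ℝ} (hy : 0 < y) :
    y ≤ 2 * (y - Real.log y - 1) + 2 := by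
  have h := Real.log_le_sub_one_of_pos (half_pos hy)
  rw [Real.log_div hy.ne' two_ne_zero] at h
  have := Real.log_two_lt_d9
  linarith

theorem sub_log_sub_one_le {y d : ℝ} (hd : 0 < d) (hy : d ≤ y) :
    y - Real.log y - 1 ≤ (y - 1) ^ 2 / d := by
  have hy0 := hd.trans_le hy
  have h := Real.one_sub_inv_le_log_of_pos hy0
  have : y - Real.log y - 1 ≤ (y - 1) ^ 2 / y := by
    have : (y - 1) ^ 2 / y = y - 1 - (1 - y⁻¹) := by field_simp
    linarith
  refine this.trans ?_
  gcongr

theorem sqrt_sub_one_sq_le {y : ℝ} (hy : 0 < y) :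
    (√y - 1) ^ 2 ≤ y - Real.log y - 1 := by
  have h := Real.log_le_sub_one_of_pos (Real.sqrt_pos.2 hy)
  rw [Real.log_sqrt hy.le] at h
  nlinarith [Real.sq_sqrt hy.le]

/-- Integral form of Grönwall's inequality. -/
theorem le_mul_exp_of_le_add_integral {N : ℝ → ℝ} (hN : Continuous N) {A C T : ℝ} (hC : 0 ≤ C)
    (h : ∀ t ∈ Icc 0 T, N t ≤ A + C * ∫ s in (0:ℝ)..t, N s) :
    ∀ t ∈ Icc 0 T, N t ≤ A * Real.exp (C * t) := by
  set y : ℝ → ℝ := fun t => A + C * ∫ s in (0:ℝ)..t, N s with hy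
  have hyd : ∀ t, HasDerivAt y (C * N t) t := fun t =>
    ((hN.integral_hasStrictDerivAt 0 t).hasDerivAt.const_mul C).const_add A
  have hzd : ∀ t, HasDerivAt (fun t => y t * Real.exp (-C * t))
      (C * N t * Real.exp (-C * t) + y t * (Real.exp (-C * t) * (-C))) t := fun t => by
    have := (hyd t).fun_mul (((hasDerivAt_id t).const_mul (-C)).exp)
    simpa using this
  have hanti : AntitoneOn (fun t => y t * Real.exp (-C * t)) (Icc 0 T) := by
    apply antitoneOn_of_deriv_nonpos (convex_Icc 0 T)
    · exact fun t _ => (hzd t).continuousAt.continuousWithinAt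
    · exact fun t _ => (hzd t).differentiableAt.differentiableWithinAt
    · intro t ht
      rw [interior_Icc] at ht
      rw [(hzd t).deriv]
      have h1 := h t ⟨ht.1.le, ht.2.le⟩
      have : C * N t * Real.exp (-C * t) + y t * (Real.exp (-C * t) * (-C))
        = -(C * (y t - N t) * Real.exp (-C * t)) := by ring
      rw [this, neg_nonpos]
      have : 0 ≤ y t - N t := sub_nonneg.2 h1
      positivity
  intro t ht
  have h1 := hanti ⟨le_rfl, ht.1.trans ht.2⟩ ht ht.1
  simp only [hy, intervalIntegral.integral_same, mul_zero, add_zero, Real.exp_zero, mul_one] at h1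
  refine (h t ht).trans ?_
  calc _ = (A + C * ∫ s in (0:ℝ)..t, N s) * Real.exp (-C * t) * Real.exp (C * t) := by
        rw [mul_assoc, ← Real.exp_add]; simp
    _ ≤ _ := by gcongr

/-- Comparison of powers: `√y` is controlled by a small multiple of `y ^ (β + 1/2)`. -/
theorem exists_sqrt_le_rpow {β : ℝ} (hβ : 0 < β) {ε : ℝ} (hε : 0 < ε) :
    ∃ C : ℝ, 0 < C ∧ ∀ y : ℝ, 0 < y → √y ≤ C + ε * y ^ (β + 1 / 2) := by
  refine ⟨√(ε ^ (-(1 / β))), by positivity, fun y hy => ?_⟩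
  have hpos : 0 ≤ ε * y ^ (β + 1 / 2) := by positivity
  rcases le_total y (ε ^ (-(1 / β))) with h | h
  · have := Real.sqrt_le_sqrt h
    linarith
  · have h1 : 1 ≤ ε * y ^ β := by
      have h2 : (ε ^ (-(1 / β))) ^ β ≤ y ^ β := by gcongr
      rw [← Real.rpow_mul hε.le] at h2
      have : -(1 / β) * β = -1 := by field_simp
      rw [this, Real.rpow_neg_one] at h2
      calc 1 = ε * ε⁻¹ := by field_simp
        _ ≤ _ := by gcongr
    have h3 : √y ≤ ε * y ^ (β + 1 / 2) := by
      rw [Real.rpow_add hy, ← Real.sqrt_eq_rpow, ← mul_assoc]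
      exact le_mul_of_one_le_left (Real.sqrt_nonneg _) h1
    have := Real.sqrt_nonneg (ε ^ (-(1 / β)))
    linarith

/-! ### Scalar form of the system, with time clamped to `[0, T]` -/

/-- A solution written in scalar components and extended to all times by freezing it outside
`[0, T]`, so that every field is continuous on the whole plane. -/
structure MHDFlow (α β T : ℝ) where
  (v u θ w₁ w₂ b₁ b₂ ux θx w₁x w₂x b₁x b₂x ut θt w₁t w₂t b₁t b₂t : ℝ → ℝ → ℝ)
  cont_v : Continuous fun p : ℝ × ℝ => v p.1 p.2
  cont_u : Continuous fun p : ℝ × ℝ => u p.1 p.2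
  cont_θ : Continuous fun p : ℝ × ℝ => θ p.1 p.2
  cont_w₁ : Continuous fun p : ℝ × ℝ => w₁ p.1 p.2
  cont_w₂ : Continuous fun p : ℝ × ℝ => w₂ p.1 p.2
  cont_b₁ : Continuous fun p : ℝ × ℝ => b₁ p.1 p.2
  cont_b₂ : Continuous fun p : ℝ × ℝ => b₂ p.1 p.2
  cont_ux : Continuous fun p : ℝ × ℝ => ux p.1 p.2
  cont_θx : Continuous fun p : ℝ × ℝ => θx p.1 p.2
  cont_w₁x : Continuous fun p : ℝ × ℝ => w₁x p.1 p.2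
  cont_w₂x : Continuous fun p : ℝ × ℝ => w₂x p.1 p.2
  cont_b₁x : Continuous fun p : ℝ × ℝ => b₁x p.1 p.2
  cont_b₂x : Continuous fun p : ℝ × ℝ => b₂x p.1 p.2
  cont_ut : Continuous fun p : ℝ × ℝ => ut p.1 p.2
  cont_θt : Continuous fun p : ℝ × ℝ => θt p.1 p.2
  cont_w₁t : Continuous fun p : ℝ × ℝ => w₁t p.1 p.2
  cont_w₂t : Continuous fun p : ℝ × ℝ => w₂t p.1 p.2
  cont_b₁t : Continuous fun p : ℝ × ℝ => b₁t p.1 p.2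
  cont_b₂t : Continuous fun p : ℝ × ℝ => b₂t p.1 p.2
  v_pos : ∀ x t, 0 < v x t
  θ_pos : ∀ x t, 0 < θ x t
  dx_u : ∀ x t, HasDerivAt (fun y => u y t) (ux x t) x
  dx_θ : ∀ x t, HasDerivAt (fun y => θ y t) (θx x t) x
  dx_w₁ : ∀ x t, HasDerivAt (fun y => w₁ y t) (w₁x x t) x
  dx_w₂ : ∀ x t, HasDerivAt (fun y => w₂ y t) (w₂x x t) x
  dx_b₁ : ∀ x t, HasDerivAt (fun y => b₁ y t) (b₁x x t) x
  dx_b₂ : ∀ x t, HasDerivAt (fun y => b₂ y t) (b₂x x t) x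
  dt_v : ∀ x, ∀ t ∈ Ioo 0 T, HasDerivAt (fun s => v x s) (ux x t) t
  dt_u : ∀ x, ∀ t ∈ Ioo 0 T, HasDerivAt (fun s => u x s) (ut x t) t
  dt_θ : ∀ x, ∀ t ∈ Ioo 0 T, HasDerivAt (fun s => θ x s) (θt x t) t
  dt_w₁ : ∀ x, ∀ t ∈ Ioo 0 T, HasDerivAt (fun s => w₁ x s) (w₁t x t) t
  dt_w₂ : ∀ x, ∀ t ∈ Ioo 0 T, HasDerivAt (fun s => w₂ x s) (w₂t x t) t
  dt_b₁ : ∀ x, ∀ t ∈ Ioo 0 T, HasDerivAt (fun s => b₁ x s) (b₁t x t) t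
  dt_b₂ : ∀ x, ∀ t ∈ Ioo 0 T, HasDerivAt (fun s => b₂ x s) (b₂t x t) t
  eq_u : ∀ x t, HasDerivAt (fun y => visc α (v y t) * ux y t / v y t
    - (θ y t / v y t + (b₁ y t ^ 2 + b₂ y t ^ 2) / 2)) (ut x t) x
  eq_w₁ : ∀ x t, HasDerivAt (fun y => w₁x y t / v y t + b₁ y t) (w₁t x t) x
  eq_w₂ : ∀ x t, HasDerivAt (fun y => w₂x y t / v y t + b₂ y t) (w₂t x t) x
  eq_b₁ : ∀ x t, HasDerivAt (fun y => b₁x y t / v y t + w₁ y t)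
    (ux x t * b₁ x t + v x t * b₁t x t) x
  eq_b₂ : ∀ x t, HasDerivAt (fun y => b₂x y t / v y t + w₂ y t)
    (ux x t * b₂ x t + v x t * b₂t x t) x
  eq_θ : ∀ x t, HasDerivAt (fun y => θ y t ^ β * θx y t / v y t)
    (θt x t + θ x t / v x t * ux x t - (visc α (v x t) * ux x t ^ 2
      + (w₁x x t ^ 2 + w₂x x t ^ 2) + (b₁x x t ^ 2 + b₂x x t ^ 2)) / v x t) x
  far : ∀ ε > 0, ∃ M : ℝ, ∀ x t, M ≤ |x| → |v x t - 1| < ε ∧ |u x t| < ε ∧ |θ x t - 1| < ε ∧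
    |w₁ x t| < ε ∧ |w₂ x t| < ε ∧ |b₁ x t| < ε ∧ |b₂ x t| < ε

/-- Bounds on the initial data that follow from admissibility. -/
structure MHDFlow.InitBound {α β T : ℝ} (F : MHDFlow α β T) (K δ : ℝ) : Prop where
  v_ge : ∀ x, δ ≤ F.v x 0
  θ_ge : ∀ x, δ ≤ F.θ x 0
  v_le : ∀ x, F.v x 0 ≤ 1 + 2 * K
  energy : ∀ A, 0 ≤ A → ∫ x in (-A)..A, ((F.v x 0 - 1) ^ 2 + F.u x 0 ^ 2 + (F.θ x 0 - 1) ^ 2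
    + (F.b₁ x 0 ^ 2 + F.b₂ x 0 ^ 2) + (F.w₁ x 0 ^ 2 + F.w₂ x 0 ^ 2)) ≤ K ^ 2

theorem max_min_mem_Icc {T : ℝ} (hT : 0 < T) (t : ℝ) : max 0 (min T t) ∈ Icc 0 T :=
  ⟨le_max_left _ _, max_le hT.le (min_le_left _ _)⟩

theorem max_min_eq_self {T t : ℝ} (ht : t ∈ Icc 0 T) : max 0 (min T t) = t := by
  rw [min_eq_right ht.2, max_eq_right ht.1]

theorem ContinuousOn.comp_clamp {E : Type*} [TopologicalSpace E] {f : ℝ × ℝ → E} {T : ℝ}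
    (hT : 0 < T) (hf : ContinuousOn f (univ ×ˢ Icc 0 T)) :
    Continuous fun p : ℝ × ℝ => f (p.1, max 0 (min T p.2)) :=
  hf.comp_continuous (by fun_prop) fun p => ⟨mem_univ _, max_min_mem_Icc hT _⟩

theorem HasDerivWithinAt.hasDerivAt_clamp {E : Type*} [NormedAddCommGroup E] [NormedSpace ℝ E]
    {f : ℝ → E} {T t : ℝ} {f' : E} (hf : HasDerivWithinAt f f' (Icc 0 T) t) (ht : t ∈ Ioo 0 T) :
    HasDerivAt (fun s => f (max 0 (min T s))) f' t := by
  refine (hf.hasDerivAt (Icc_mem_nhds ht.1 ht.2)).congr_of_eventuallyEq ?_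
  filter_upwards [Icc_mem_nhds ht.1 ht.2] with s hs
  rw [max_min_eq_self hs]

theorem HasDerivAt.comp_fst {f : ℝ → ℝ × ℝ} {f' : ℝ × ℝ} {x : ℝ} (hf : HasDerivAt f f' x) :
    HasDerivAt (fun y => (f y).1) f'.1 x :=
  (ContinuousLinearMap.fst ℝ ℝ ℝ).hasFDerivAt.comp_hasDerivAt x hf

theorem HasDerivAt.comp_snd {f : ℝ → ℝ × ℝ} {f' : ℝ × ℝ} {x : ℝ} (hf : HasDerivAt f f' x) :
    HasDerivAt (fun y => (f y).2) f'.2 x :=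
  (ContinuousLinearMap.snd ℝ ℝ ℝ).hasFDerivAt.comp_hasDerivAt x hf

namespace IsClassicalSolution

variable {α β T : ℝ} {v u θ : ℝ → ℝ → ℝ} {w b : ℝ → ℝ → ℝ × ℝ}

theorem hasDerivAt_flux_u (h : IsClassicalSolution α β T v u θ w b) (x : ℝ) {t : ℝ}
    (ht : t ∈ Icc 0 T) :
    HasDerivAt (fun y => visc α (v y t) * pdx u y t / v y t
      - (θ y t / v y t + ((b y t).1 ^ 2 + (b y t).2 ^ 2) / 2)) (pdt T u x t) x := by
  obtain ⟨hv, hu, hθ, hw, hb⟩ := h.diff_x x t ht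
  obtain ⟨hux, -, -, -⟩ := h.diff_xx x t ht
  have hv0 := (h.v_pos x t ht).ne'
  have hb1 : DifferentiableAt ℝ (fun y => (b y t).1) x := hb.fst
  have hb2 : DifferentiableAt ℝ (fun y => (b y t).2) x := hb.snd
  have d1 : DifferentiableAt ℝ (fun y => visc α (v y t) * pdx u y t / v y t) x := by
    unfold visc
    exact (((hv.rpow_const (Or.inl hv0)).const_mul α).const_add 1 |>.mul hux).div hv hv0
  have d2 : DifferentiableAt ℝ (fun y => θ y t / v y t + sq2 (b y t) / 2) x := by
    unfold sq2
    exact (hθ.div hv hv0).add (((hb1.pow 2).add (hb2.pow 2)).div_const 2)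
  have e := h.eq_mom x t ht
  have := d1.hasDerivAt.sub d2.hasDerivAt
  exact this.congr_deriv (eq_sub_of_add_eq e).symm

theorem hasDerivAt_flux_w (h : IsClassicalSolution α β T v u θ w b) (x : ℝ) {t : ℝ}
    (ht : t ∈ Icc 0 T) :
    HasDerivAt (fun y => (v y t)⁻¹ • pdx w y t + b y t) (pdt T w x t) x := by
  obtain ⟨hv, hu, hθ, hw, hb⟩ := h.diff_x x t ht
  obtain ⟨-, -, hwx, -⟩ := h.diff_xx x t ht
  have hv0 := (h.v_pos x t ht).ne'
  have d1 : DifferentiableAt ℝ (fun y => (v y t)⁻¹ • pdx w y t) x := (hv.inv hv0).smul hwx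
  exact (d1.hasDerivAt.add hb.hasDerivAt).congr_deriv
    (sub_eq_iff_eq_add.1 (h.eq_w x t ht)).symm

theorem hasDerivAt_flux_b (hT : 0 < T) (h : IsClassicalSolution α β T v u θ w b) (x : ℝ) {t : ℝ}
    (ht : t ∈ Icc 0 T) :
    HasDerivAt (fun y => (v y t)⁻¹ • pdx b y t + w y t)
      (pdx u x t • b x t + v x t • pdt T b x t) x := by
  obtain ⟨hv, hu, hθ, hw, hb⟩ := h.diff_x x t ht
  obtain ⟨-, -, -, hbx⟩ := h.diff_xx x t ht
  obtain ⟨hvt, -, -, -, hbt⟩ := h.diff_t x t ht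
  have hv0 := (h.v_pos x t ht).ne'
  have d1 : DifferentiableAt ℝ (fun y => (v y t)⁻¹ • pdx b y t) x := (hv.inv hv0).smul hbx
  have e := sub_eq_iff_eq_add.1 (h.eq_b x t ht)
  have e2 : pdt T (fun y s => v y s • b y s) x t = pdx u x t • b x t + v x t • pdt T b x t := by
    have := (hvt.hasDerivWithinAt.smul hbt.hasDerivWithinAt).derivWithin
      (uniqueDiffOn_Icc hT t ht)
    rw [← h.eq_mass x t ht, add_comm]
    exact this
  exact (d1.hasDerivAt.add hw.hasDerivAt).congr_deriv (e.symm.trans e2)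

theorem hasDerivAt_flux_θ (h : IsClassicalSolution α β T v u θ w b) (x : ℝ) {t : ℝ}
    (ht : t ∈ Icc 0 T) :
    HasDerivAt (fun y => θ y t ^ β * pdx θ y t / v y t)
      (pdt T θ x t + θ x t / v x t * pdx u x t
        - (visc α (v x t) * pdx u x t ^ 2 + sq2 (pdx w x t) + sq2 (pdx b x t)) / v x t) x := by
  obtain ⟨hv, hu, hθ, hw, hb⟩ := h.diff_x x t ht
  obtain ⟨-, hθx, -, -⟩ := h.diff_xx x t ht
  have hv0 := (h.v_pos x t ht).ne'
  have hθ0 := (h.θ_pos x t ht).ne'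
  have d1 : DifferentiableAt ℝ (fun y => θ y t ^ β * pdx θ y t / v y t) x :=
    ((hθ.rpow_const (Or.inl hθ0)).mul hθx).div hv hv0
  exact d1.hasDerivAt.congr_deriv (sub_eq_iff_eq_add.2 (h.eq_temp x t ht)).symm

/-- The scalar form of a classical solution. -/
def toFlow (hT : 0 < T) (h : IsClassicalSolution α β T v u θ w b) : MHDFlow α β T where
  v x t := v x (max 0 (min T t))
  u x t := u x (max 0 (min T t))
  θ x t := θ x (max 0 (min T t))
  w₁ x t := (w x (max 0 (min T t))).1
  w₂ x t := (w x (max 0 (min T t))).2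
  b₁ x t := (b x (max 0 (min T t))).1
  b₂ x t := (b x (max 0 (min T t))).2
  ux x t := pdx u x (max 0 (min T t))
  θx x t := pdx θ x (max 0 (min T t))
  w₁x x t := (pdx w x (max 0 (min T t))).1
  w₂x x t := (pdx w x (max 0 (min T t))).2
  b₁x x t := (pdx b x (max 0 (min T t))).1
  b₂x x t := (pdx b x (max 0 (min T t))).2
  ut x t := pdt T u x (max 0 (min T t))
  θt x t := pdt T θ x (max 0 (min T t))
  w₁t x t := (pdt T w x (max 0 (min T t))).1
  w₂t x t := (pdt T w x (max 0 (min T t))).2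
  b₁t x t := (pdt T b x (max 0 (min T t))).1
  b₂t x t := (pdt T b x (max 0 (min T t))).2
  cont_v := (h.cont.comp_clamp hT).fst
  cont_u := (h.cont.comp_clamp hT).snd.fst
  cont_θ := (h.cont.comp_clamp hT).snd.snd.fst
  cont_w₁ := (h.cont.comp_clamp hT).snd.snd.snd.fst.fst
  cont_w₂ := (h.cont.comp_clamp hT).snd.snd.snd.fst.snd
  cont_b₁ := (h.cont.comp_clamp hT).snd.snd.snd.snd.fst
  cont_b₂ := (h.cont.comp_clamp hT).snd.snd.snd.snd.snd
  cont_ux := (h.cont_dx.comp_clamp hT).snd.fst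
  cont_θx := (h.cont_dx.comp_clamp hT).snd.snd.fst
  cont_w₁x := (h.cont_dx.comp_clamp hT).snd.snd.snd.fst.fst
  cont_w₂x := (h.cont_dx.comp_clamp hT).snd.snd.snd.fst.snd
  cont_b₁x := (h.cont_dx.comp_clamp hT).snd.snd.snd.snd.fst
  cont_b₂x := (h.cont_dx.comp_clamp hT).snd.snd.snd.snd.snd
  cont_ut := (h.cont_dt.comp_clamp hT).snd.fst
  cont_θt := (h.cont_dt.comp_clamp hT).snd.snd.fst
  cont_w₁t := (h.cont_dt.comp_clamp hT).snd.snd.snd.fst.fst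
  cont_w₂t := (h.cont_dt.comp_clamp hT).snd.snd.snd.fst.snd
  cont_b₁t := (h.cont_dt.comp_clamp hT).snd.snd.snd.snd.fst
  cont_b₂t := (h.cont_dt.comp_clamp hT).snd.snd.snd.snd.snd
  v_pos x t := h.v_pos x _ (max_min_mem_Icc hT t)
  θ_pos x t := h.θ_pos x _ (max_min_mem_Icc hT t)
  dx_u x t := (h.diff_x x _ (max_min_mem_Icc hT t)).2.1.hasDerivAt
  dx_θ x t := (h.diff_x x _ (max_min_mem_Icc hT t)).2.2.1.hasDerivAt
  dx_w₁ x t := (h.diff_x x _ (max_min_mem_Icc hT t)).2.2.2.1.hasDerivAt.comp_fst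
  dx_w₂ x t := (h.diff_x x _ (max_min_mem_Icc hT t)).2.2.2.1.hasDerivAt.comp_snd
  dx_b₁ x t := (h.diff_x x _ (max_min_mem_Icc hT t)).2.2.2.2.hasDerivAt.comp_fst
  dx_b₂ x t := (h.diff_x x _ (max_min_mem_Icc hT t)).2.2.2.2.hasDerivAt.comp_snd
  dt_v x t ht := by
    have ht' := Ioo_subset_Icc_self ht
    have := (h.diff_t x t ht').1.hasDerivWithinAt.hasDerivAt_clamp ht
    rw [max_min_eq_self ht', ← h.eq_mass x t ht']
    exact this
  dt_u x t ht := by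
    have ht' := Ioo_subset_Icc_self ht
    rw [max_min_eq_self ht']
    exact (h.diff_t x t ht').2.1.hasDerivWithinAt.hasDerivAt_clamp ht
  dt_θ x t ht := by
    have ht' := Ioo_subset_Icc_self ht
    rw [max_min_eq_self ht']
    exact (h.diff_t x t ht').2.2.1.hasDerivWithinAt.hasDerivAt_clamp ht
  dt_w₁ x t ht := by
    have ht' := Ioo_subset_Icc_self ht
    rw [max_min_eq_self ht']
    exact ((h.diff_t x t ht').2.2.2.1.hasDerivWithinAt.hasDerivAt_clamp ht).comp_fst
  dt_w₂ x t ht := by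
    have ht' := Ioo_subset_Icc_self ht
    rw [max_min_eq_self ht']
    exact ((h.diff_t x t ht').2.2.2.1.hasDerivWithinAt.hasDerivAt_clamp ht).comp_snd
  dt_b₁ x t ht := by
    have ht' := Ioo_subset_Icc_self ht
    rw [max_min_eq_self ht']
    exact ((h.diff_t x t ht').2.2.2.2.hasDerivWithinAt.hasDerivAt_clamp ht).comp_fst
  dt_b₂ x t ht := by
    have ht' := Ioo_subset_Icc_self ht
    rw [max_min_eq_self ht']
    exact ((h.diff_t x t ht').2.2.2.2.hasDerivWithinAt.hasDerivAt_clamp ht).comp_snd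
  eq_u x t := h.hasDerivAt_flux_u x (max_min_mem_Icc hT t)
  eq_w₁ x t := by
    simpa [div_eq_inv_mul] using (h.hasDerivAt_flux_w x (max_min_mem_Icc hT t)).comp_fst
  eq_w₂ x t := by
    simpa [div_eq_inv_mul] using (h.hasDerivAt_flux_w x (max_min_mem_Icc hT t)).comp_snd
  eq_b₁ x t := by
    simpa [div_eq_inv_mul] using (h.hasDerivAt_flux_b hT x (max_min_mem_Icc hT t)).comp_fst
  eq_b₂ x t := by
    simpa [div_eq_inv_mul] using (h.hasDerivAt_flux_b hT x (max_min_mem_Icc hT t)).comp_snd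
  eq_θ x t := h.hasDerivAt_flux_θ x (max_min_mem_Icc hT t)
  far ε hε := by
    obtain ⟨M, hM⟩ := h.farfield ε hε
    refine ⟨M, fun x t hx => ?_⟩
    obtain ⟨h1, h2, h3, h4, h5⟩ := hM x _ (max_min_mem_Icc hT t) hx
    refine ⟨h1, h2, h3, ?_, ?_, ?_, ?_⟩
    · exact (Real.abs_le_sqrt (le_add_of_nonneg_right (sq_nonneg _))).trans_lt h5
    · exact (Real.abs_le_sqrt (le_add_of_nonneg_left (sq_nonneg _))).trans_lt h5
    · exact (Real.abs_le_sqrt (le_add_of_nonneg_right (sq_nonneg _))).trans_lt h4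
    · exact (Real.abs_le_sqrt (le_add_of_nonneg_left (sq_nonneg _))).trans_lt h4

theorem toFlow_initBound (hT : 0 < T) (h : IsClassicalSolution α β T v u θ w b) {K δ : ℝ}
    (hK : 0 < K) (ha : Admissible K δ v u θ w b) : (h.toFlow hT).InitBound K δ := by
  have h0 : (0:ℝ) ∈ Icc 0 T := ⟨le_rfl, hT.le⟩
  have hc0 : max 0 (min T 0) = 0 := max_min_eq_self h0
  obtain ⟨i1, i2, i3, i4, i5, i6, i7, i8, i9, i10⟩ := h.sq_int 0 h0
  obtain ⟨hI0, hv, hθ⟩ := ha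
  have hI := ((((((((i1.add i2).add i3).add i4).add i5).add i6).add i7).add i8).add i9).add i10
  have hsq : ∀ p, 0 ≤ sq2 p := fun p => by unfold sq2; positivity
  have hpos : ∀ x, 0 ≤ (v x 0 - 1) ^ 2 + (u x 0) ^ 2 + (θ x 0 - 1) ^ 2 + sq2 (b x 0)
      + sq2 (w x 0) + (pdx v x 0) ^ 2 + (pdx u x 0) ^ 2 + (pdx θ x 0) ^ 2
      + sq2 (pdx b x 0) + sq2 (pdx w x 0) := fun x => by
    have := hsq (b x 0); have := hsq (w x 0); have := hsq (pdx b x 0); have := hsq (pdx w x 0)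
    positivity
  have key : ∀ f : ℝ → ℝ, Continuous f → (∀ x, f x ≤ (v x 0 - 1) ^ 2 + (u x 0) ^ 2
      + (θ x 0 - 1) ^ 2 + sq2 (b x 0)
      + sq2 (w x 0) + (pdx v x 0) ^ 2 + (pdx u x 0) ^ 2 + (pdx θ x 0) ^ 2
      + sq2 (pdx b x 0) + sq2 (pdx w x 0)) → ∀ c d, c ≤ d → ∫ x in c..d, f x ≤ K ^ 2 := by
    intro f hf hle c d hcd
    refine le_trans ?_ hI0
    rw [intervalIntegral.integral_of_le hcd]
    refine (setIntegral_mono_on ((hf.intervalIntegrable c d).1) hI.integrableOn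
      measurableSet_Ioc fun x _ => hle x).trans ?_
    exact setIntegral_le_integral hI (Eventually.of_forall hpos)
  have hslice : ∀ {E : Type} [TopologicalSpace E] {f : ℝ × ℝ → E},
      ContinuousOn f (univ ×ˢ Icc 0 T) → Continuous fun x : ℝ => f (x, 0) := fun hf =>
    hf.comp_continuous (by fun_prop) fun p => ⟨mem_univ _, h0⟩
  have c1 := (hslice h.cont)
  have cv : Continuous fun x => v x 0 := c1.fst
  have cu : Continuous fun x => u x 0 := c1.snd.fst
  have cθ : Continuous fun x => θ x 0 := c1.snd.snd.fst
  have cw : Continuous fun x => w x 0 := c1.snd.snd.snd.fst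
  have cb : Continuous fun x => b x 0 := c1.snd.snd.snd.snd
  have cvx : Continuous fun x => pdx v x 0 := (hslice h.cont_dx).fst
  have pos' : ∀ x, 0 ≤ sq2 (b x 0) ∧ 0 ≤ sq2 (w x 0) ∧ 0 ≤ sq2 (pdx b x 0) ∧
    0 ≤ sq2 (pdx w x 0) ∧ 0 ≤ (pdx v x 0) ^ 2 ∧ 0 ≤ (pdx u x 0) ^ 2 ∧ 0 ≤ (pdx θ x 0) ^ 2 ∧
    0 ≤ (u x 0) ^ 2 ∧ 0 ≤ (θ x 0 - 1) ^ 2 :=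
    fun x => ⟨hsq _, hsq _, hsq _, hsq _, sq_nonneg _, sq_nonneg _, sq_nonneg _, sq_nonneg _,
      sq_nonneg _⟩
  refine ⟨fun x => ?_, fun x => ?_, fun x => ?_, fun A hA => ?_⟩
  · simpa [toFlow, hc0] using hv x
  · simpa [toFlow, hc0] using hθ x
  · have e : (h.toFlow hT).v x 0 = v x 0 := by simp [toFlow]
    rw [e]
    have k1 := key (fun x => (v x 0 - 1) ^ 2 + (pdx v x 0) ^ 2) (by fun_prop)
      (fun x => by have := pos' x; linarith)
    obtain ⟨y, hy, hyK⟩ := exists_le_of_integral_le (f := fun x => (v x 0 - 1) ^ 2) (C := K ^ 2)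
      (by fun_prop) (key _ (by fun_prop)
        (fun x => by have := pos' x; linarith) x (x + 1) (by linarith))
    have hd : ∀ z, HasDerivAt (fun z => (v z 0 - 1) ^ 2) (2 * (v z 0 - 1) * pdx v z 0) z :=
      fun z => by
        have := ((h.diff_x z 0 h0).1.hasDerivAt.sub_const 1).fun_pow 2
        simpa [pdx] using this
    have ftc := intervalIntegral.integral_eq_sub_of_hasDerivAt (a := x) (b := y)
      (fun z _ => hd z) (by apply Continuous.intervalIntegrable; fun_prop)
    have k2 : -K ^ 2 ≤ ∫ z in x..y, 2 * (v z 0 - 1) * pdx v z 0 := by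
      have := k1 x y hy.1
      have h3 : ∫ z in x..y, -((v z 0 - 1) ^ 2 + (pdx v z 0) ^ 2)
          ≤ ∫ z in x..y, 2 * (v z 0 - 1) * pdx v z 0 := by
        apply intervalIntegral.integral_mono_on hy.1
        · apply Continuous.intervalIntegrable; fun_prop
        · apply Continuous.intervalIntegrable; fun_prop
        · intro z _
          nlinarith [sq_nonneg (v z 0 - 1 + pdx v z 0)]
      rw [intervalIntegral.integral_neg] at h3
      linarith
    nlinarith
  · have k := key (fun x => (v x 0 - 1) ^ 2 + u x 0 ^ 2 + (θ x 0 - 1) ^ 2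
        + ((b x 0).1 ^ 2 + (b x 0).2 ^ 2) + ((w x 0).1 ^ 2 + (w x 0).2 ^ 2))
      (by fun_prop) (fun x => by have := pos' x; unfold sq2 at *; linarith) (-A) A (by linarith)
    simpa [toFlow, hc0] using k

end IsClassicalSolution

/-! ### The weighted energy inequality -/

/-- A convex function `H` of the temperature with derivative `h < 1` and second derivative `k > 0`,
used as a renormalization of the temperature equation. -/
structure Renorm where
  (H h k : ℝ → ℝ)
  deriv_H : ∀ y > 0, HasDerivAt H (h y) y
  deriv_h : ∀ y > 0, HasDerivAt h (k y) y
  cont_k : ContinuousOn k (Ioi 0)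
  k_pos : ∀ y > 0, 0 < k y
  h_lt : ∀ y > 0, h y < 1
  H_nonneg : ∀ y > 0, 0 ≤ H y
  H_le : ∀ y > 0, H y ≤ y - Real.log y - 1

theorem Renorm.continuousOn_H (M : Renorm) : ContinuousOn M.H (Ioi 0) :=
  fun y hy => (M.deriv_H y hy).continuousAt.continuousWithinAt

theorem Renorm.continuousOn_h (M : Renorm) : ContinuousOn M.h (Ioi 0) :=
  fun y hy => (M.deriv_h y hy).continuousAt.continuousWithinAt

theorem continuousOn_visc (α : ℝ) : ContinuousOn (visc α) (Ioi 0) := by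
  intro y hy
  unfold visc
  exact ((((Real.continuousAt_rpow_const y _ (Or.inl (ne_of_gt hy))).const_mul α).const_add
    1)).continuousWithinAt

theorem one_le_visc {α : ℝ} (hα : 0 ≤ α) {y : ℝ} (hy : 0 < y) : 1 ≤ visc α y := by
  unfold visc
  have := Real.rpow_nonneg hy.le (-α)
  nlinarith [mul_nonneg hα this]

namespace MHDFlow

section Continuity

variable {α β T : ℝ} {X : Type*} [TopologicalSpace X] {a c : X → ℝ}

@[fun_prop]
theorem continuous_v (F : MHDFlow α β T) (ha : Continuous a) (hc : Continuous c) :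
    Continuous fun x => F.v (a x) (c x) :=
  F.cont_v.comp (ha.prodMk hc)

@[fun_prop]
theorem continuous_u (F : MHDFlow α β T) (ha : Continuous a) (hc : Continuous c) :
    Continuous fun x => F.u (a x) (c x) :=
  F.cont_u.comp (ha.prodMk hc)

@[fun_prop]
theorem continuous_θ (F : MHDFlow α β T) (ha : Continuous a) (hc : Continuous c) :
    Continuous fun x => F.θ (a x) (c x) :=
  F.cont_θ.comp (ha.prodMk hc)

@[fun_prop]
theorem continuous_w₁ (F : MHDFlow α β T) (ha : Continuous a) (hc : Continuous c) :
    Continuous fun x => F.w₁ (a x) (c x) :=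
  F.cont_w₁.comp (ha.prodMk hc)

@[fun_prop]
theorem continuous_w₂ (F : MHDFlow α β T) (ha : Continuous a) (hc : Continuous c) :
    Continuous fun x => F.w₂ (a x) (c x) :=
  F.cont_w₂.comp (ha.prodMk hc)

@[fun_prop]
theorem continuous_b₁ (F : MHDFlow α β T) (ha : Continuous a) (hc : Continuous c) :
    Continuous fun x => F.b₁ (a x) (c x) :=
  F.cont_b₁.comp (ha.prodMk hc)

@[fun_prop]
theorem continuous_b₂ (F : MHDFlow α β T) (ha : Continuous a) (hc : Continuous c) :
    Continuous fun x => F.b₂ (a x) (c x) :=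
  F.cont_b₂.comp (ha.prodMk hc)

@[fun_prop]
theorem continuous_ux (F : MHDFlow α β T) (ha : Continuous a) (hc : Continuous c) :
    Continuous fun x => F.ux (a x) (c x) :=
  F.cont_ux.comp (ha.prodMk hc)

@[fun_prop]
theorem continuous_θx (F : MHDFlow α β T) (ha : Continuous a) (hc : Continuous c) :
    Continuous fun x => F.θx (a x) (c x) :=
  F.cont_θx.comp (ha.prodMk hc)

@[fun_prop]
theorem continuous_w₁x (F : MHDFlow α β T) (ha : Continuous a) (hc : Continuous c) :
    Continuous fun x => F.w₁x (a x) (c x) :=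
  F.cont_w₁x.comp (ha.prodMk hc)

@[fun_prop]
theorem continuous_w₂x (F : MHDFlow α β T) (ha : Continuous a) (hc : Continuous c) :
    Continuous fun x => F.w₂x (a x) (c x) :=
  F.cont_w₂x.comp (ha.prodMk hc)

@[fun_prop]
theorem continuous_b₁x (F : MHDFlow α β T) (ha : Continuous a) (hc : Continuous c) :
    Continuous fun x => F.b₁x (a x) (c x) :=
  F.cont_b₁x.comp (ha.prodMk hc)

@[fun_prop]
theorem continuous_b₂x (F : MHDFlow α β T) (ha : Continuous a) (hc : Continuous c) :
    Continuous fun x => F.b₂x (a x) (c x) :=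
  F.cont_b₂x.comp (ha.prodMk hc)

@[fun_prop]
theorem continuous_ut (F : MHDFlow α β T) (ha : Continuous a) (hc : Continuous c) :
    Continuous fun x => F.ut (a x) (c x) :=
  F.cont_ut.comp (ha.prodMk hc)

@[fun_prop]
theorem continuous_θt (F : MHDFlow α β T) (ha : Continuous a) (hc : Continuous c) :
    Continuous fun x => F.θt (a x) (c x) :=
  F.cont_θt.comp (ha.prodMk hc)

@[fun_prop]
theorem continuous_w₁t (F : MHDFlow α β T) (ha : Continuous a) (hc : Continuous c) :
    Continuous fun x => F.w₁t (a x) (c x) :=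
  F.cont_w₁t.comp (ha.prodMk hc)

@[fun_prop]
theorem continuous_w₂t (F : MHDFlow α β T) (ha : Continuous a) (hc : Continuous c) :
    Continuous fun x => F.w₂t (a x) (c x) :=
  F.cont_w₂t.comp (ha.prodMk hc)

@[fun_prop]
theorem continuous_b₁t (F : MHDFlow α β T) (ha : Continuous a) (hc : Continuous c) :
    Continuous fun x => F.b₁t (a x) (c x) :=
  F.cont_b₁t.comp (ha.prodMk hc)

@[fun_prop]
theorem continuous_b₂t (F : MHDFlow α β T) (ha : Continuous a) (hc : Continuous c) :
    Continuous fun x => F.b₂t (a x) (c x) :=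
  F.cont_b₂t.comp (ha.prodMk hc)

theorem continuous_comp_v (F : MHDFlow α β T) {g : ℝ → ℝ} (hg : ContinuousOn g (Ioi 0))
    (ha : Continuous a) (hc : Continuous c) : Continuous fun x => g (F.v (a x) (c x)) :=
  hg.comp_continuous (by fun_prop) fun _ => F.v_pos _ _

theorem continuous_comp_θ (F : MHDFlow α β T) {g : ℝ → ℝ} (hg : ContinuousOn g (Ioi 0))
    (ha : Continuous a) (hc : Continuous c) : Continuous fun x => g (F.θ (a x) (c x)) :=
  hg.comp_continuous (by fun_prop) fun _ => F.θ_pos _ _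

end Continuity

variable {α β T : ℝ}

/-- The viscosity along the flow. -/
def vis (F : MHDFlow α β T) (x t : ℝ) : ℝ := visc α (F.v x t)

/-- The heat conductivity along the flow. -/
def kap (F : MHDFlow α β T) (x t : ℝ) : ℝ := F.θ x t ^ β

/-- Logarithm of the specific volume along the flow. -/
def logv (F : MHDFlow α β T) (x t : ℝ) : ℝ := Real.log (F.v x t)

/-- `H(θ)` along the flow. -/
def Hθ (F : MHDFlow α β T) (M : Renorm) (x t : ℝ) : ℝ := M.H (F.θ x t)

/-- The first derivative of `H` at `θ` along the flow. -/
def hθ (F : MHDFlow α β T) (M : Renorm) (x t : ℝ) : ℝ := M.h (F.θ x t)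

/-- The second derivative of `H` at `θ` along the flow. -/
def kθ (F : MHDFlow α β T) (M : Renorm) (x t : ℝ) : ℝ := M.k (F.θ x t)

section Continuity

variable {X : Type*} [TopologicalSpace X] {a c : X → ℝ}

@[fun_prop]
theorem continuous_vis (F : MHDFlow α β T) (ha : Continuous a) (hc : Continuous c) :
    Continuous fun x => F.vis (a x) (c x) :=
  F.continuous_comp_v (continuousOn_visc α) ha hc

@[fun_prop]
theorem continuous_kap (F : MHDFlow α β T) (ha : Continuous a) (hc : Continuous c) :
    Continuous fun x => F.kap (a x) (c x) :=
  F.continuous_comp_θ (g := fun y => y ^ β)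
    (continuousOn_id.rpow_const fun _ hy => Or.inl (ne_of_gt hy)) ha hc

@[fun_prop]
theorem continuous_logv (F : MHDFlow α β T) (ha : Continuous a) (hc : Continuous c) :
    Continuous fun x => F.logv (a x) (c x) :=
  F.continuous_comp_v (continuousOn_id.log fun _ hy => ne_of_gt hy) ha hc

@[fun_prop]
theorem continuous_Hθ (F : MHDFlow α β T) (M : Renorm) (ha : Continuous a) (hc : Continuous c) :
    Continuous fun x => F.Hθ M (a x) (c x) :=
  F.continuous_comp_θ M.continuousOn_H ha hc

@[fun_prop]
theorem continuous_hθ (F : MHDFlow α β T) (M : Renorm) (ha : Continuous a) (hc : Continuous c) :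
    Continuous fun x => F.hθ M (a x) (c x) :=
  F.continuous_comp_θ M.continuousOn_h ha hc

@[fun_prop]
theorem continuous_kθ (F : MHDFlow α β T) (M : Renorm) (ha : Continuous a) (hc : Continuous c) :
    Continuous fun x => F.kθ M (a x) (c x) :=
  F.continuous_comp_θ M.cont_k ha hc

end Continuity

theorem v_ne (F : MHDFlow α β T) (x t : ℝ) : F.v x t ≠ 0 := (F.v_pos x t).ne'

theorem θ_ne (F : MHDFlow α β T) (x t : ℝ) : F.θ x t ≠ 0 := (F.θ_pos x t).ne'

theorem one_sub_hθ_pos (F : MHDFlow α β T) (M : Renorm) (x t : ℝ) : 0 < 1 - F.hθ M x t :=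
  sub_pos.2 (M.h_lt _ (F.θ_pos x t))

theorem kθ_pos (F : MHDFlow α β T) (M : Renorm) (x t : ℝ) : 0 < F.kθ M x t :=
  M.k_pos _ (F.θ_pos x t)

theorem kap_pos (F : MHDFlow α β T) (x t : ℝ) : 0 < F.kap x t :=
  Real.rpow_pos_of_pos (F.θ_pos x t) β

/-- The renormalized energy density. -/
def energy (F : MHDFlow α β T) (M : Renorm) (x t : ℝ) : ℝ :=
  F.Hθ M x t + (F.v x t - F.logv x t - 1)
    + (F.u x t ^ 2 + (F.w₁ x t ^ 2 + F.w₂ x t ^ 2)) / 2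
    + F.v x t * (F.b₁ x t ^ 2 + F.b₂ x t ^ 2) / 2

/-- The time derivative of the renormalized energy density. -/
def energyDt (F : MHDFlow α β T) (M : Renorm) (x t : ℝ) : ℝ :=
  F.hθ M x t * F.θt x t + (F.ux x t - F.ux x t / F.v x t)
    + (F.u x t * F.ut x t + (F.w₁ x t * F.w₁t x t + F.w₂ x t * F.w₂t x t))
    + (F.ux x t * (F.b₁ x t ^ 2 + F.b₂ x t ^ 2) / 2
      + F.v x t * (F.b₁ x t * F.b₁t x t + F.b₂ x t * F.b₂t x t))

/-- Mechanical, magnetic and viscous dissipation, weighted by one minus the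
first derivative of `H` at `θ`. -/
def dissKin (F : MHDFlow α β T) (M : Renorm) (x t : ℝ) : ℝ :=
  (1 - F.hθ M x t) * ((F.vis x t * F.ux x t ^ 2 + (F.w₁x x t ^ 2 + F.w₂x x t ^ 2)
    + (F.b₁x x t ^ 2 + F.b₂x x t ^ 2)) / F.v x t)

/-- Thermal dissipation, weighted by the second derivative of `H` at `θ`. -/
def dissHeat (F : MHDFlow α β T) (M : Renorm) (x t : ℝ) : ℝ :=
  F.kθ M x t * F.kap x t * F.θx x t ^ 2 / F.v x t

/-- The pressure remainder left after absorbing part of the viscous dissipation. -/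
def remainder (F : MHDFlow α β T) (M : Renorm) (x t : ℝ) : ℝ :=
  ((1 - F.hθ M x t) * F.θ x t - 1) ^ 2 / ((1 - F.hθ M x t) * F.v x t)

/-- The pressure work term in the renormalized energy balance. -/
def work (F : MHDFlow α β T) (M : Renorm) (x t : ℝ) : ℝ :=
  ((1 - F.hθ M x t) * F.θ x t - 1) * F.ux x t / F.v x t

/-- The flux in the renormalized energy balance. -/
def flux (F : MHDFlow α β T) (M : Renorm) (x t : ℝ) : ℝ :=
  F.u x t * (F.vis x t * F.ux x t / F.v x t
      - (F.θ x t / F.v x t + (F.b₁ x t ^ 2 + F.b₂ x t ^ 2) / 2) + 1)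
    + (F.w₁ x t * (F.w₁x x t / F.v x t + F.b₁ x t) + F.w₂ x t * (F.w₂x x t / F.v x t + F.b₂ x t))
    + (F.b₁ x t * (F.b₁x x t / F.v x t + F.w₁ x t) + F.b₂ x t * (F.b₂x x t / F.v x t + F.w₂ x t))
    - (F.w₁ x t * F.b₁ x t + F.w₂ x t * F.b₂ x t)
    + F.hθ M x t * (F.kap x t * F.θx x t / F.v x t)

section Continuity

variable {X : Type*} [TopologicalSpace X] {a c : X → ℝ}

@[fun_prop]
theorem continuous_energy (F : MHDFlow α β T) (M : Renorm) (ha : Continuous a)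
    (hc : Continuous c) : Continuous fun x => F.energy M (a x) (c x) := by
  unfold energy; fun_prop

@[fun_prop]
theorem continuous_energyDt (F : MHDFlow α β T) (M : Renorm) (ha : Continuous a)
    (hc : Continuous c) : Continuous fun x => F.energyDt M (a x) (c x) := by
  unfold energyDt; fun_prop (disch := intros; exact F.v_ne _ _)

@[fun_prop]
theorem continuous_dissKin (F : MHDFlow α β T) (M : Renorm) (ha : Continuous a)
    (hc : Continuous c) : Continuous fun x => F.dissKin M (a x) (c x) := by
  unfold dissKin; fun_prop (disch := intros; exact F.v_ne _ _)

@[fun_prop]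
theorem continuous_dissHeat (F : MHDFlow α β T) (M : Renorm) (ha : Continuous a)
    (hc : Continuous c) : Continuous fun x => F.dissHeat M (a x) (c x) := by
  unfold dissHeat; fun_prop (disch := intros; exact F.v_ne _ _)

@[fun_prop]
theorem continuous_remainder (F : MHDFlow α β T) (M : Renorm) (ha : Continuous a)
    (hc : Continuous c) : Continuous fun x => F.remainder M (a x) (c x) := by
  unfold remainder
  fun_prop (disch := intros; exact (mul_pos (F.one_sub_hθ_pos M _ _) (F.v_pos _ _)).ne')

@[fun_prop]
theorem continuous_work (F : MHDFlow α β T) (M : Renorm) (ha : Continuous a)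
    (hc : Continuous c) : Continuous fun x => F.work M (a x) (c x) := by
  unfold work; fun_prop (disch := intros; exact F.v_ne _ _)

@[fun_prop]
theorem continuous_flux (F : MHDFlow α β T) (M : Renorm) (ha : Continuous a)
    (hc : Continuous c) : Continuous fun x => F.flux M (a x) (c x) := by
  unfold flux; fun_prop (disch := intros; exact F.v_ne _ _)

end Continuity

theorem hasDerivAt_energy (F : MHDFlow α β T) (M : Renorm) (x : ℝ) {t : ℝ} (ht : t ∈ Ioo 0 T) :
    HasDerivAt (fun s => F.energy M x s) (F.energyDt M x t) t := by
  have hv := F.dt_v x t ht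
  have hH : HasDerivAt (fun s => F.Hθ M x s) (F.hθ M x t * F.θt x t) t :=
    (M.deriv_H _ (F.θ_pos x t)).comp t (F.dt_θ x t ht)
  have hl : HasDerivAt (fun s => F.logv x s) (F.ux x t / F.v x t) t := hv.log (F.v_ne x t)
  have hu := (F.dt_u x t ht).fun_pow 2
  have hw₁ := (F.dt_w₁ x t ht).fun_pow 2
  have hw₂ := (F.dt_w₂ x t ht).fun_pow 2
  have hb₁ := (F.dt_b₁ x t ht).fun_pow 2
  have hb₂ := (F.dt_b₂ x t ht).fun_pow 2
  refine (((hH.fun_add ((hv.fun_sub hl).sub_const 1)).fun_add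
    ((hu.fun_add (hw₁.fun_add hw₂)).div_const 2)).fun_add
    ((hv.fun_mul (hb₁.fun_add hb₂)).div_const 2)).congr_deriv ?_
  unfold energyDt
  ring

theorem hasDerivAt_flux (F : MHDFlow α β T) (M : Renorm) (x t : ℝ) :
    HasDerivAt (fun y => F.flux M y t)
      (F.energyDt M x t + F.dissKin M x t + F.dissHeat M x t - F.work M x t) x := by
  have hh : HasDerivAt (fun y => F.hθ M y t) (F.kθ M x t * F.θx x t) x :=
    (M.deriv_h _ (F.θ_pos x t)).comp x (F.dx_θ x t)
  have e1 := (F.dx_u x t).fun_mul ((F.eq_u x t).add_const 1)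
  have e2 := ((F.dx_w₁ x t).fun_mul (F.eq_w₁ x t)).fun_add ((F.dx_w₂ x t).fun_mul (F.eq_w₂ x t))
  have e3 := ((F.dx_b₁ x t).fun_mul (F.eq_b₁ x t)).fun_add ((F.dx_b₂ x t).fun_mul (F.eq_b₂ x t))
  have e4 := ((F.dx_w₁ x t).fun_mul (F.dx_b₁ x t)).fun_add ((F.dx_w₂ x t).fun_mul (F.dx_b₂ x t))
  have e5 := hh.fun_mul (F.eq_θ x t)
  refine ((((e1.fun_add e2).fun_add e3).fun_sub e4).fun_add e5).congr_deriv ?_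
  unfold energyDt dissKin dissHeat work kap vis
  have := F.v_ne x t
  field_simp
  ring

theorem dissKin_nonneg (F : MHDFlow α β T) (hα : 0 ≤ α) (M : Renorm) (x t : ℝ) :
    0 ≤ F.dissKin M x t := by
  have h1 := F.one_sub_hθ_pos M x t
  have h2 : 0 ≤ F.vis x t := zero_le_one.trans (one_le_visc hα (F.v_pos x t))
  have h3 := F.v_pos x t
  unfold dissKin
  positivity

theorem dissHeat_nonneg (F : MHDFlow α β T) (M : Renorm) (x t : ℝ) :
    0 ≤ F.dissHeat M x t := by
  have h1 := F.kθ_pos M x t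
  have h2 := F.kap_pos x t
  have h3 := F.v_pos x t
  unfold dissHeat
  positivity

theorem remainder_nonneg (F : MHDFlow α β T) (M : Renorm) (x t : ℝ) :
    0 ≤ F.remainder M x t := by
  have h1 := F.one_sub_hθ_pos M x t
  have h3 := F.v_pos x t
  unfold remainder
  positivity

theorem energy_nonneg (F : MHDFlow α β T) (M : Renorm) (x t : ℝ) : 0 ≤ F.energy M x t := by
  have h1 : 0 ≤ F.Hθ M x t := M.H_nonneg _ (F.θ_pos x t)
  have h2 : 0 ≤ F.v x t - F.logv x t - 1 := sub_log_sub_one_nonneg (F.v_pos x t)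
  have h3 := F.v_pos x t
  unfold energy
  positivity

end MHDFlow

/-- A compactly supported weight on `[-R, R]`. -/
def cutoff (R x : ℝ) : ℝ := (1 - (x / R) ^ 2) ^ 2

@[fun_prop]
theorem continuous_cutoff (R : ℝ) : Continuous (cutoff R) := by
  unfold cutoff; fun_prop

theorem cutoff_nonneg (R x : ℝ) : 0 ≤ cutoff R x := sq_nonneg _

theorem abs_div_le_one {R x : ℝ} (hx : x ∈ Icc (-R) R) : |x / R| ≤ 1 := by
  rw [abs_div]
  exact div_le_one_of_le₀ ((abs_le.2 hx).trans (le_abs_self R)) (abs_nonneg _)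

theorem one_sub_sq_mem {s : ℝ} (hs : |s| ≤ 1) : 1 - s ^ 2 ∈ Icc 0 1 :=
  ⟨by linarith [(sq_le_one_iff_abs_le_one s).2 hs], by nlinarith⟩

theorem cutoff_le_one {R x : ℝ} (hx : x ∈ Icc (-R) R) : cutoff R x ≤ 1 := by
  have := one_sub_sq_mem (abs_div_le_one hx)
  unfold cutoff
  nlinarith [this.1, this.2]

theorem half_le_cutoff {R x A : ℝ} (hR : 0 < R) (hA : 2 * A ≤ R) (hx : x ∈ Icc (-A) A) :
    1 / 2 ≤ cutoff R x := by
  have h1 : |x / R| ≤ 1 / 2 := by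
    rw [abs_div, abs_of_pos hR, div_le_iff₀ hR]
    linarith [abs_le.2 hx]
  have h2 : (x / R) ^ 2 ≤ 1 / 4 := by
    rw [← sq_abs]
    nlinarith [abs_nonneg (x / R)]
  unfold cutoff
  nlinarith

theorem hasDerivAt_cutoff (R x : ℝ) :
    HasDerivAt (cutoff R) (-(4 * (x / R / R) * (1 - (x / R) ^ 2))) x := by
  refine ((((((hasDerivAt_id x).div_const R).fun_pow 2).const_sub 1)).fun_pow 2).congr_deriv ?_
  simp only [id]
  ring

theorem four_mul_mul_le {D Q X e ρ r : ℝ} (hD : 0 ≤ D) (hQ : 0 ≤ Q) (hX : X ^ 2 = D * Q)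
    (he : e ^ 2 ≤ r) : 4 * e * ρ * X ≤ ρ ^ 2 * D / 4 + 16 * r * Q := by
  have h : 4 * e * ρ * X ≤ ρ ^ 2 * D / 4 + 16 * e ^ 2 * Q := by
    refine le_of_abs_le (abs_le_of_sq_le_sq ?_ (by positivity))
    have : (4 * e * ρ * X) ^ 2 = 16 * e ^ 2 * ρ ^ 2 * (D * Q) := by rw [← hX]; ring
    rw [this]
    nlinarith [sq_nonneg (ρ ^ 2 * D / 4 - 16 * e ^ 2 * Q)]
  nlinarith

theorem exists_abs_le_of_far {f : ℝ → ℝ → ℝ} (hf : Continuous fun p : ℝ × ℝ => f p.1 p.2)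
    {B c : ℝ} (h : ∀ x t, B ≤ |x| → |f x t| ≤ c) (T : ℝ) :
    ∃ C, 0 ≤ C ∧ ∀ x, ∀ t ∈ Icc 0 T, |f x t| ≤ C := by
  obtain ⟨C, hC⟩ := ((isCompact_Icc (a := -B) (b := B)).prod
    (isCompact_Icc (a := (0:ℝ)) (b := T))).exists_bound_of_continuousOn hf.continuousOn
  refine ⟨max (max C c) 0, le_max_right _ _, fun x t ht => ?_⟩
  rcases le_total B |x| with hx | hx
  · exact (h x t hx).trans ((le_max_right _ _).trans (le_max_left _ _))
  · exact (hC (x, t) ⟨abs_le.1 hx, ht⟩).trans ((le_max_left _ _).trans (le_max_left _ _))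

namespace MHDFlow

variable {α β T : ℝ}

theorem exists_abs_comp_v_le (F : MHDFlow α β T) {g : ℝ → ℝ} (hg : ContinuousOn g (Ioi 0)) :
    ∃ C, 0 ≤ C ∧ ∀ x, ∀ t ∈ Icc 0 T, |g (F.v x t)| ≤ C := by
  obtain ⟨B, hB⟩ := F.far (1 / 2) (by norm_num)
  obtain ⟨c, hc⟩ := (isCompact_Icc (a := (1/2 : ℝ)) (b := 3/2)).exists_bound_of_continuousOn
    (hg.mono fun y hy => lt_of_lt_of_le (by norm_num) hy.1)
  refine exists_abs_le_of_far (F.continuous_comp_v hg continuous_fst continuous_snd)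
    (B := B) (c := c) (fun x t hx => hc _ ?_) T
  have := abs_lt.1 (hB x t hx).1
  constructor <;> linarith

theorem exists_abs_comp_θ_le (F : MHDFlow α β T) {g : ℝ → ℝ} (hg : ContinuousOn g (Ioi 0)) :
    ∃ C, 0 ≤ C ∧ ∀ x, ∀ t ∈ Icc 0 T, |g (F.θ x t)| ≤ C := by
  obtain ⟨B, hB⟩ := F.far (1 / 2) (by norm_num)
  obtain ⟨c, hc⟩ := (isCompact_Icc (a := (1/2 : ℝ)) (b := 3/2)).exists_bound_of_continuousOn
    (hg.mono fun y hy => lt_of_lt_of_le (by norm_num) hy.1)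
  refine exists_abs_le_of_far (F.continuous_comp_θ hg continuous_fst continuous_snd)
    (B := B) (c := c) (fun x t hx => hc _ ?_) T
  have := abs_lt.1 (hB x t hx).2.2.1
  constructor <;> linarith

/-- The part of the flux that contains no spatial derivatives. -/
def fluxLow (F : MHDFlow α β T) (x t : ℝ) : ℝ :=
  F.u x t * (1 - F.θ x t / F.v x t - (F.b₁ x t ^ 2 + F.b₂ x t ^ 2) / 2)
    + (F.w₁ x t * F.b₁ x t + F.w₂ x t * F.b₂ x t)

/-- The coefficient produced by absorbing the cutoff error terms into the dissipation. -/
def cutoffError (F : MHDFlow α β T) (M : Renorm) (x t : ℝ) : ℝ :=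
  F.u x t ^ 2 * (F.vis x t / (F.v x t * (1 - F.hθ M x t)))
    + ((F.w₁ x t ^ 2 + F.w₂ x t ^ 2) + (F.b₁ x t ^ 2 + F.b₂ x t ^ 2))
      * (1 / (F.v x t * (1 - F.hθ M x t)))
    + F.hθ M x t ^ 2 * F.kap x t / (F.kθ M x t * F.v x t)

theorem exists_fluxLow_le (F : MHDFlow α β T) :
    ∃ C, 0 ≤ C ∧ ∀ x, ∀ t ∈ Icc 0 T, |x| * |F.fluxLow x t| ≤ C + |x| / 16 := by
  obtain ⟨B, hB⟩ := F.far (1 / 80) (by norm_num)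
  have hc : Continuous fun p : ℝ × ℝ => F.fluxLow p.1 p.2 := by
    unfold fluxLow; fun_prop (disch := intros; exact F.v_ne _ _)
  have hsmall : ∀ x t, B ≤ |x| → |F.fluxLow x t| ≤ 1 / 16 := by
    intro x t hx
    obtain ⟨h1, h2, h3, h4, h5, h6, h7⟩ := hB x t hx
    rw [abs_lt] at h1 h2 h3 h4 h5 h6 h7
    have hv := F.v_pos x t
    have e : |1 - F.θ x t / F.v x t - (F.b₁ x t ^ 2 + F.b₂ x t ^ 2) / 2| ≤ 1 := by
      have l1 : F.θ x t / F.v x t ≤ 3 / 2 := by rw [div_le_iff₀ hv]; linarith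
      have l2 : 1 / 2 ≤ F.θ x t / F.v x t := by rw [le_div_iff₀ hv]; linarith
      have l3 : F.b₁ x t ^ 2 ≤ 1 / 80 := by nlinarith
      have l4 : F.b₂ x t ^ 2 ≤ 1 / 80 := by nlinarith
      rw [abs_le]; constructor <;> nlinarith [sq_nonneg (F.b₁ x t), sq_nonneg (F.b₂ x t)]
    have hprod : ∀ p q : ℝ, -(1/80) < p ∧ p < 1/80 → |q| ≤ 1 → |p * q| ≤ 1 / 80 := by
      intro p q hp hq
      rw [abs_mul]
      have := abs_lt.2 hp
      nlinarith [abs_nonneg p, abs_nonneg q]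
    have hb : ∀ q : ℝ, -(1/80) < q ∧ q < 1/80 → |q| ≤ 1 := fun q hq => by
      linarith [abs_lt.2 hq]
    have a1 := abs_le.1 (hprod _ _ h2 e)
    have a2 := abs_le.1 (hprod _ _ h4 (hb _ h6))
    have a3 := abs_le.1 (hprod _ _ h5 (hb _ h7))
    unfold fluxLow
    rw [abs_le]; constructor <;> linarith
  obtain ⟨C, hC0, hC⟩ := exists_abs_le_of_far hc hsmall T
  refine ⟨|B| * C, by positivity, fun x t ht => ?_⟩
  rcases le_total B |x| with hx | hx
  · have := mul_le_mul_of_nonneg_left (hsmall x t hx) (abs_nonneg x)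
    nlinarith [mul_nonneg (abs_nonneg B) hC0]
  · have := mul_le_mul (hx.trans (le_abs_self B)) (hC x t ht) (abs_nonneg _) (abs_nonneg B)
    linarith [abs_nonneg x]

theorem exists_cutoffError_le (F : MHDFlow α β T) (hα : 0 ≤ α) (M : Renorm) :
    ∃ C, 0 ≤ C ∧ ∀ x, ∀ t ∈ Icc 0 T, F.cutoffError M x t ≤ C := by
  obtain ⟨B, hB⟩ := F.far 1 one_pos
  obtain ⟨U, hU0, hU⟩ := exists_abs_le_of_far F.cont_u (fun x t hx => (hB x t hx).2.1.le) T
  obtain ⟨W₁, hW₁0, hW₁⟩ :=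
    exists_abs_le_of_far F.cont_w₁ (fun x t hx => (hB x t hx).2.2.2.1.le) T
  obtain ⟨W₂, hW₂0, hW₂⟩ :=
    exists_abs_le_of_far F.cont_w₂ (fun x t hx => (hB x t hx).2.2.2.2.1.le) T
  obtain ⟨B₁, hB₁0, hB₁⟩ :=
    exists_abs_le_of_far F.cont_b₁ (fun x t hx => (hB x t hx).2.2.2.2.2.1.le) T
  obtain ⟨B₂, hB₂0, hB₂⟩ :=
    exists_abs_le_of_far F.cont_b₂ (fun x t hx => (hB x t hx).2.2.2.2.2.2.le) T
  obtain ⟨V, hV0, hV⟩ := F.exists_abs_comp_v_le (g := fun y => 1 / y)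
    (continuousOn_const.div continuousOn_id fun y hy => ne_of_gt hy)
  obtain ⟨S, hS0, hS⟩ := F.exists_abs_comp_v_le (continuousOn_visc α)
  obtain ⟨G, hG0, hG⟩ := F.exists_abs_comp_θ_le (g := fun y => 1 / (1 - M.h y))
    (continuousOn_const.div (continuousOn_const.sub M.continuousOn_h)
      fun y hy => (sub_pos.2 (M.h_lt y hy)).ne')
  obtain ⟨P, hP0, hP⟩ := F.exists_abs_comp_θ_le (g := fun y => M.h y ^ 2 * y ^ β / M.k y)
    (((M.continuousOn_h.pow 2).mul (continuousOn_id.rpow_const fun y hy => Or.inl (ne_of_gt hy))).div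
      M.cont_k fun y hy => (M.k_pos y hy).ne')
  refine ⟨U ^ 2 * (S * (V * G)) + ((W₁ ^ 2 + W₂ ^ 2) + (B₁ ^ 2 + B₂ ^ 2)) * (V * G) + P * V,
    by positivity, fun x t ht => ?_⟩
  have sqle : ∀ {p q : ℝ}, |p| ≤ q → p ^ 2 ≤ q ^ 2 := fun {p q} h => by
    rw [← sq_abs]; gcongr
  have g := F.one_sub_hθ_pos M x t
  have hv := F.v_pos x t
  have hv' : 0 < 1 / F.v x t := by positivity
  have hg' : 0 < 1 / (1 - F.hθ M x t) := by positivity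
  have hvis : 0 ≤ F.vis x t := zero_le_one.trans (one_le_visc hα hv)
  have hk := F.kθ_pos M x t
  have hκ := F.kap_pos x t
  have e : F.cutoffError M x t = F.u x t ^ 2 * (F.vis x t * (1 / F.v x t * (1 / (1 - F.hθ M x t))))
      + ((F.w₁ x t ^ 2 + F.w₂ x t ^ 2) + (F.b₁ x t ^ 2 + F.b₂ x t ^ 2))
        * (1 / F.v x t * (1 / (1 - F.hθ M x t)))
      + F.hθ M x t ^ 2 * F.kap x t / F.kθ M x t * (1 / F.v x t) := by
    unfold cutoffError
    field_simp
  rw [e]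
  have i1 := sqle (hU x t ht)
  have i2 := sqle (hW₁ x t ht)
  have i3 := sqle (hW₂ x t ht)
  have i4 := sqle (hB₁ x t ht)
  have i5 := sqle (hB₂ x t ht)
  have i6 : 1 / F.v x t ≤ V := le_of_abs_le (hV x t ht)
  have i7 : F.vis x t ≤ S := le_of_abs_le (hS x t ht)
  have i8 : 1 / (1 - F.hθ M x t) ≤ G := le_of_abs_le (hG x t ht)
  have i9 : F.hθ M x t ^ 2 * F.kap x t / F.kθ M x t ≤ P := le_of_abs_le (hP x t ht)
  gcongr

theorem work_le (F : MHDFlow α β T) (hα : 0 ≤ α) (M : Renorm) (x t : ℝ) :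
    F.work M x t ≤ F.dissKin M x t / 4 + F.remainder M x t := by
  have g := F.one_sub_hθ_pos M x t
  have hv := F.v_pos x t
  have hvis : 1 ≤ F.vis x t := one_le_visc hα hv
  have h1 : F.work M x t
      ≤ (1 - F.hθ M x t) * (F.ux x t ^ 2 / F.v x t) / 4 + F.remainder M x t := by
    have : (1 - F.hθ M x t) * (F.ux x t ^ 2 / F.v x t) / 4 + F.remainder M x t - F.work M x t
        = ((1 - F.hθ M x t) * F.ux x t / 2 - ((1 - F.hθ M x t) * F.θ x t - 1)) ^ 2
          / ((1 - F.hθ M x t) * F.v x t) := by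
      unfold remainder work
      field_simp
      ring
    have h2 : 0 ≤ ((1 - F.hθ M x t) * F.ux x t / 2 - ((1 - F.hθ M x t) * F.θ x t - 1)) ^ 2
          / ((1 - F.hθ M x t) * F.v x t) := by positivity
    linarith
  have h3 : (1 - F.hθ M x t) * (F.ux x t ^ 2 / F.v x t) ≤ F.dissKin M x t := by
    unfold dissKin
    gcongr
    nlinarith [sq_nonneg (F.ux x t), sq_nonneg (F.w₁x x t), sq_nonneg (F.w₂x x t),
      sq_nonneg (F.b₁x x t), sq_nonneg (F.b₂x x t)]
  linarith

theorem four_mul_flux_le (F : MHDFlow α β T) (hα : 0 ≤ α) (M : Renorm) (x t : ℝ) {e ρ r : ℝ}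
    (he : e ^ 2 ≤ r) :
    4 * e * ρ * F.flux M x t ≤ ρ ^ 2 * (F.dissKin M x t + F.dissHeat M x t) / 4
      + 16 * r * F.cutoffError M x t + 4 * e * ρ * F.fluxLow x t := by
  have g := F.one_sub_hθ_pos M x t
  have hv := F.v_pos x t
  have hvis : 0 ≤ F.vis x t := zero_le_one.trans (one_le_visc hα hv)
  have hk := F.kθ_pos M x t
  have hκ := F.kap_pos x t
  have key : ∀ p q : ℝ, 4 * e * ρ * (p * q / F.v x t)
      ≤ ρ ^ 2 * ((1 - F.hθ M x t) * (q ^ 2 / F.v x t)) / 4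
        + 16 * r * (p ^ 2 * (1 / (F.v x t * (1 - F.hθ M x t)))) := fun p q =>
    four_mul_mul_le (by positivity) (by positivity) (by field_simp) he
  have k1 : 4 * e * ρ * (F.u x t * F.vis x t * F.ux x t / F.v x t)
      ≤ ρ ^ 2 * ((1 - F.hθ M x t) * (F.vis x t * F.ux x t ^ 2 / F.v x t)) / 4
        + 16 * r * (F.u x t ^ 2 * (F.vis x t / (F.v x t * (1 - F.hθ M x t)))) :=
    four_mul_mul_le (by positivity) (by positivity) (by field_simp) he
  have k2 : 4 * e * ρ * (F.hθ M x t * F.kap x t * F.θx x t / F.v x t)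
      ≤ ρ ^ 2 * F.dissHeat M x t / 4
        + 16 * r * (F.hθ M x t ^ 2 * F.kap x t / (F.kθ M x t * F.v x t)) :=
    four_mul_mul_le (F.dissHeat_nonneg M x t) (by positivity)
      (by unfold dissHeat; field_simp) he
  have k3 := key (F.w₁ x t) (F.w₁x x t)
  have k4 := key (F.w₂ x t) (F.w₂x x t)
  have k5 := key (F.b₁ x t) (F.b₁x x t)
  have k6 := key (F.b₂ x t) (F.b₂x x t)
  have e1 : 4 * e * ρ * F.flux M x t = 4 * e * ρ * (F.u x t * F.vis x t * F.ux x t / F.v x t)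
      + 4 * e * ρ * (F.w₁ x t * F.w₁x x t / F.v x t) + 4 * e * ρ * (F.w₂ x t * F.w₂x x t / F.v x t)
      + 4 * e * ρ * (F.b₁ x t * F.b₁x x t / F.v x t) + 4 * e * ρ * (F.b₂ x t * F.b₂x x t / F.v x t)
      + 4 * e * ρ * (F.hθ M x t * F.kap x t * F.θx x t / F.v x t)
      + 4 * e * ρ * F.fluxLow x t := by
    unfold flux fluxLow; ring
  have e2 : F.dissKin M x t = (1 - F.hθ M x t) * (F.vis x t * F.ux x t ^ 2 / F.v x t)
      + (1 - F.hθ M x t) * (F.w₁x x t ^ 2 / F.v x t) + (1 - F.hθ M x t) * (F.w₂x x t ^ 2 / F.v x t)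
      + (1 - F.hθ M x t) * (F.b₁x x t ^ 2 / F.v x t)
      + (1 - F.hθ M x t) * (F.b₂x x t ^ 2 / F.v x t) := by
    unfold dissKin; ring
  rw [e1, e2]
  unfold cutoffError
  linarith

theorem exists_cutoff_flux_le (F : MHDFlow α β T) (hα : 0 ≤ α) (M : Renorm) :
    ∃ R₀ > 0, ∀ R ≥ R₀, ∀ t ∈ Icc 0 T, ∀ x ∈ Icc (-R) R,
      4 * (x / R / R) * (1 - (x / R) ^ 2) * F.flux M x t
        + cutoff R x * (F.work M x t - F.dissKin M x t - F.dissHeat M x t)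
      ≤ cutoff R x * F.remainder M x t - cutoff R x * F.dissKin M x t / 2
        - 3 / 4 * (cutoff R x * F.dissHeat M x t) + 1 / R := by
  obtain ⟨C₁, hC₁0, hC₁⟩ := F.exists_cutoffError_le hα M
  obtain ⟨C₂, hC₂0, hC₂⟩ := F.exists_fluxLow_le
  refine ⟨2 * (16 * C₁ + 4 * C₂) + 1, by positivity, fun R hR t ht x hx => ?_⟩
  have hR0 : 0 < R := by linarith
  have hs := abs_div_le_one hx
  have hρ := one_sub_sq_mem hs
  have he : (x / R / R) ^ 2 ≤ 1 / R ^ 2 := by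
    rw [div_pow (x / R)]
    gcongr
    exact (sq_le_one_iff_abs_le_one _).2 hs
  have h1 := F.four_mul_flux_le hα M x t (ρ := 1 - (x / R) ^ 2) he
  have h2 := mul_le_mul_of_nonneg_left (F.work_le hα M x t) (cutoff_nonneg R x)
  have h3 : 4 * (x / R / R) * (1 - (x / R) ^ 2) * F.fluxLow x t
      ≤ 4 * C₂ / R ^ 2 + 1 / (4 * R) := by
    have hx' : |x| ≤ R := abs_le.2 hx
    calc 4 * (x / R / R) * (1 - (x / R) ^ 2) * F.fluxLow x t
        ≤ |4 * (x / R / R) * (1 - (x / R) ^ 2) * F.fluxLow x t| := le_abs_self _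
      _ = 4 / R ^ 2 * (1 - (x / R) ^ 2) * (|x| * |F.fluxLow x t|) := by
          simp only [abs_mul, abs_div, abs_of_pos hR0, abs_of_nonneg hρ.1]
          rw [abs_of_pos (by norm_num : (0:ℝ) < 4)]
          field_simp
      _ ≤ 4 / R ^ 2 * 1 * (C₂ + R / 16) := by
          gcongr
          · exact hρ.2
          · exact (hC₂ x t ht).trans (by gcongr)
      _ = 4 * C₂ / R ^ 2 + 1 / (4 * R) := by field_simp; ring
  have h4 : 16 * (1 / R ^ 2) * F.cutoffError M x t ≤ 16 * C₁ / R ^ 2 := by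
    rw [mul_one_div, div_mul_eq_mul_div]
    gcongr
    exact hC₁ x t ht
  have h5 : (16 * C₁ + 4 * C₂) / R ^ 2 ≤ 1 / (2 * R) := by
    rw [div_le_div_iff₀ (by positivity) (by positivity)]
    nlinarith
  have h6 : 1 / R = 1 / (2 * R) + 1 / (4 * R) + 1 / (4 * R) := by field_simp; norm_num
  have h7 : 0 ≤ 1 / (4 * R) := by positivity
  have h8 : (1 - (x / R) ^ 2) ^ 2 = cutoff R x := rfl
  rw [h8] at h1
  rw [add_div] at h5
  linarith

end MHDFlow

theorem integral_le_two_mul_integral_cutoff {f : ℝ → ℝ} (hf : Continuous f) (h0 : ∀ x, 0 ≤ f x)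
    {A R : ℝ} (hA : 0 ≤ A) (hR : 0 < R) (hAR : 2 * A ≤ R) :
    ∫ x in (-A)..A, f x ≤ 2 * ∫ x in (-R)..R, cutoff R x * f x := by
  rw [← intervalIntegral.integral_const_mul]
  refine le_trans ?_ (integral_le_of_subinterval (f := fun x => 2 * (cutoff R x * f x))
    (b := A) (by fun_prop) (fun x => ?_) (by linarith : -R ≤ -A) (by linarith) (by linarith))
  · have hc : Continuous fun x => 2 * (cutoff R x * f x) := by fun_prop
    refine intervalIntegral.integral_mono_on (μ := volume) (by linarith)
      (hf.intervalIntegrable _ _) (hc.intervalIntegrable _ _) fun x hx => ?_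
    nlinarith [half_le_cutoff hR hAR hx, h0 x]
  · have := cutoff_nonneg R x
    have := h0 x
    positivity

namespace MHDFlow

variable {α β T : ℝ}

theorem exists_integral_cutoff_energyDt_le (F : MHDFlow α β T) (hα : 0 ≤ α) (M : Renorm) :
    ∃ R₀ > 0, ∀ R ≥ R₀, ∀ t ∈ Icc 0 T,
      ∫ x in (-R)..R, cutoff R x * F.energyDt M x t
        ≤ (∫ x in (-R)..R, cutoff R x * F.remainder M x t)
          - (∫ x in (-R)..R, cutoff R x * F.dissKin M x t) / 2
          - 3 / 4 * (∫ x in (-R)..R, cutoff R x * F.dissHeat M x t) + 2 := by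
  obtain ⟨R₀, hR₀, h⟩ := F.exists_cutoff_flux_le hα M
  refine ⟨R₀, hR₀, fun R hR t ht => ?_⟩
  have hR0 : 0 < R := hR₀.trans_le hR
  have hd : ∀ x, HasDerivAt (fun y => cutoff R y * F.flux M y t)
      (cutoff R x * F.energyDt M x t - (4 * (x / R / R) * (1 - (x / R) ^ 2) * F.flux M x t
        + cutoff R x * (F.work M x t - F.dissKin M x t - F.dissHeat M x t))) x := fun x =>
    ((hasDerivAt_cutoff R x).fun_mul (F.hasDerivAt_flux M x t)).congr_deriv (by ring)
  have hc : Continuous fun x => 4 * (x / R / R) * (1 - (x / R) ^ 2) * F.flux M x t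
      + cutoff R x * (F.work M x t - F.dissKin M x t - F.dissHeat M x t) := by fun_prop
  have h1 := intervalIntegral.integral_eq_sub_of_hasDerivAt (a := -R) (b := R) (fun x _ => hd x)
    (Continuous.intervalIntegrable (by fun_prop) _ _)
  have hz : cutoff R R = 0 := by unfold cutoff; field_simp; norm_num
  have hz' : cutoff R (-R) = 0 := by unfold cutoff; field_simp; norm_num
  rw [hz, hz', intervalIntegral.integral_sub (Continuous.intervalIntegrable (by fun_prop) _ _)
    (hc.intervalIntegrable _ _)] at h1
  have hc' : Continuous fun x => cutoff R x * F.remainder M x t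
      - cutoff R x * F.dissKin M x t / 2 - 3 / 4 * (cutoff R x * F.dissHeat M x t) + 1 / R := by
    fun_prop
  have h2 := intervalIntegral.integral_mono_on (μ := volume) (by linarith)
    (hc.intervalIntegrable (-R) R)
    (hc'.intervalIntegrable (-R) R) (h R hR t ht)
  have h3 : ∫ x in (-R)..R, (cutoff R x * F.remainder M x t - cutoff R x * F.dissKin M x t / 2
        - 3 / 4 * (cutoff R x * F.dissHeat M x t) + 1 / R)
      = (∫ x in (-R)..R, cutoff R x * F.remainder M x t)
          - (∫ x in (-R)..R, cutoff R x * F.dissKin M x t) / 2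
          - 3 / 4 * (∫ x in (-R)..R, cutoff R x * F.dissHeat M x t) + 2 := by
    rw [intervalIntegral.integral_add, intervalIntegral.integral_sub,
      intervalIntegral.integral_sub, intervalIntegral.integral_div,
      intervalIntegral.integral_const_mul, intervalIntegral.integral_const, smul_eq_mul]
    · field_simp; ring
    all_goals exact Continuous.intervalIntegrable (by fun_prop) _ _
  linarith

/-- The weighted energy estimate on `[-A, A]`. -/
theorem integral_energy_add_le (F : MHDFlow α β T) (hα : 0 ≤ α) (M : Renorm) {E C : ℝ}
    (hC : 0 ≤ C) (h0 : ∀ A, 0 ≤ A → ∫ x in (-A)..A, F.energy M x 0 ≤ E)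
    (hrem : ∃ R₁, ∀ R ≥ R₁, ∀ t ∈ Icc 0 T, ∫ x in (-R)..R, cutoff R x * F.remainder M x t
      ≤ C + (∫ x in (-R)..R, cutoff R x * F.dissHeat M x t) / 4)
    {A : ℝ} (hA : 0 ≤ A) {t : ℝ} (ht : t ∈ Icc 0 T) :
    (∫ x in (-A)..A, F.energy M x t)
      + (∫ s in (0:ℝ)..t, ∫ x in (-A)..A, (F.dissKin M x s + F.dissHeat M x s)) / 2
    ≤ 2 * (E + (C + 2) * T) := by
  obtain ⟨R₀, hR₀, h1⟩ := F.exists_integral_cutoff_energyDt_le hα M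
  obtain ⟨R₁, h2⟩ := hrem
  set R := max (max R₀ R₁) (2 * A)
  have hRR₀ : R₀ ≤ R := (le_max_left _ _).trans (le_max_left _ _)
  have hRR₁ : R₁ ≤ R := (le_max_right _ _).trans (le_max_left _ _)
  have hAR : 2 * A ≤ R := le_max_right _ _
  have hR : 0 < R := hR₀.trans_le hRR₀
  have e := integral_mul_sub_eq_integral_integral (f := F.energy M) (ft := F.energyDt M)
    (by fun_prop) (by fun_prop) (continuous_cutoff R) (fun x s hs => F.hasDerivAt_energy M x hs)
    ht (-R) R
  have cD : Continuous fun s => ∫ x in (-R)..R, cutoff R x * (F.dissKin M x s + F.dissHeat M x s) :=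
    continuous_intervalIntegral_left
      (f := fun x s => cutoff R x * (F.dissKin M x s + F.dissHeat M x s)) (by fun_prop) _ _
  have h3 : ∫ s in (0:ℝ)..t, ∫ x in (-R)..R, cutoff R x * F.energyDt M x s
      ≤ ∫ s in (0:ℝ)..t, ((C + 2)
        - (∫ x in (-R)..R, cutoff R x * (F.dissKin M x s + F.dissHeat M x s)) / 2) := by
    refine intervalIntegral.integral_mono_on ht.1 ?_
      (Continuous.intervalIntegrable (by fun_prop) _ _) fun s hs => ?_
    · exact (continuous_intervalIntegral_left (f := fun x s => cutoff R x * F.energyDt M x s)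
        (by fun_prop) _ _).intervalIntegrable _ _
    · have hs' : s ∈ Icc 0 T := ⟨hs.1, hs.2.trans ht.2⟩
      have i1 := h1 R hRR₀ s hs'
      have i2 := h2 R hRR₁ s hs'
      simp only [mul_add]
      rw [intervalIntegral.integral_add (Continuous.intervalIntegrable (by fun_prop) _ _)
        (Continuous.intervalIntegrable (by fun_prop) _ _)]
      linarith
  rw [intervalIntegral.integral_sub (Continuous.intervalIntegrable (by fun_prop) _ _)
    ((cD.div_const 2).intervalIntegrable _ _), intervalIntegral.integral_const,
    intervalIntegral.integral_div, smul_eq_mul] at h3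
  have h4 : ∫ x in (-R)..R, cutoff R x * F.energy M x 0 ≤ E := by
    refine le_trans (intervalIntegral.integral_mono_on (by linarith)
      (Continuous.intervalIntegrable (by fun_prop) _ _)
      (Continuous.intervalIntegrable (by fun_prop) _ _) fun x hx => ?_) (h0 R hR.le)
    exact mul_le_of_le_one_left (F.energy_nonneg M x 0) (cutoff_le_one hx)
  have h5 := integral_le_two_mul_integral_cutoff (f := fun x => F.energy M x t) (by fun_prop)
    (fun x => F.energy_nonneg M x t) hA hR hAR
  have h6 : ∫ s in (0:ℝ)..t, ∫ x in (-A)..A, (F.dissKin M x s + F.dissHeat M x s)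
      ≤ ∫ s in (0:ℝ)..t, 2 * ∫ x in (-R)..R, cutoff R x * (F.dissKin M x s + F.dissHeat M x s) := by
    refine intervalIntegral.integral_mono_on ht.1 ?_ ((cD.const_mul 2).intervalIntegrable _ _)
      fun s _ => integral_le_two_mul_integral_cutoff (by fun_prop)
        (fun x => add_nonneg (F.dissKin_nonneg hα M x s) (F.dissHeat_nonneg M x s)) hA hR hAR
    exact (continuous_intervalIntegral_left (f := fun x s => F.dissKin M x s + F.dissHeat M x s)
      (by fun_prop) _ _).intervalIntegrable _ _
  rw [intervalIntegral.integral_const_mul] at h6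
  have h7 : (C + 2) * t ≤ (C + 2) * T := by gcongr; exact ht.2
  linarith

theorem InitBound.integral_energy_le {F : MHDFlow α β T} {K δ : ℝ} (h : F.InitBound K δ)
    (hK : 0 < K) (hδ : 0 < δ) (hδ₁ : δ ≤ 1) (M : Renorm) {A : ℝ} (hA : 0 ≤ A) :
    ∫ x in (-A)..A, F.energy M x 0 ≤ (1 / δ + 1 + 2 * K) * K ^ 2 := by
  refine le_trans ?_ (mul_le_mul_of_nonneg_left (h.energy A hA) (by positivity))
  rw [← intervalIntegral.integral_const_mul]
  refine intervalIntegral.integral_mono_on (by linarith)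
    (Continuous.intervalIntegrable (by fun_prop) _ _)
    (Continuous.intervalIntegrable (by fun_prop) _ _) fun x _ => ?_
  have h1 : F.Hθ M x 0 ≤ 1 / δ * (F.θ x 0 - 1) ^ 2 := by
    have := (M.H_le _ (F.θ_pos x 0)).trans (sub_log_sub_one_le hδ (h.θ_ge x))
    unfold Hθ
    rwa [one_div_mul_eq_div]
  have h2 : F.v x 0 - F.logv x 0 - 1 ≤ 1 / δ * (F.v x 0 - 1) ^ 2 := by
    rw [one_div_mul_eq_div]
    exact sub_log_sub_one_le hδ (h.v_ge x)
  have h3 : 1 ≤ 1 / δ := by rw [le_div_iff₀ hδ]; linarith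
  have h4 : F.v x 0 * (F.b₁ x 0 ^ 2 + F.b₂ x 0 ^ 2)
      ≤ (1 + 2 * K) * (F.b₁ x 0 ^ 2 + F.b₂ x 0 ^ 2) := by gcongr; exact h.v_le x
  set d := 1 / δ
  have q : ∀ y : ℝ, 0 ≤ d * y ^ 2 ∧ 0 ≤ (1 + 2 * K) * y ^ 2 ∧ 0 ≤ (d - 1) * y ^ 2 := fun y =>
    ⟨by positivity, by positivity, mul_nonneg (by linarith) (sq_nonneg y)⟩
  unfold MHDFlow.energy
  obtain ⟨a1, a2, a3⟩ := q (F.v x 0 - 1)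
  obtain ⟨b1, b2, b3⟩ := q (F.u x 0)
  obtain ⟨c1, c2, c3⟩ := q (F.θ x 0 - 1)
  obtain ⟨d1, d2, d3⟩ := q (F.b₁ x 0)
  obtain ⟨e1, e2, e3⟩ := q (F.b₂ x 0)
  obtain ⟨f1, f2, f3⟩ := q (F.w₁ x 0)
  obtain ⟨g1, g2, g3⟩ := q (F.w₂ x 0)
  have n : ∀ y : ℝ, 0 ≤ y ^ 2 := fun y => sq_nonneg y
  linarith [n (F.u x 0), n (F.w₁ x 0), n (F.w₂ x 0), n (F.b₁ x 0), n (F.b₂ x 0)]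

end MHDFlow

/-! ### The entropy estimate -/

/-- The renormalization by the entropy `θ - log θ - 1`. -/
def entropyRenorm : Renorm where
  H y := y - Real.log y - 1
  h y := 1 - y⁻¹
  k y := (y ^ 2)⁻¹
  deriv_H y hy := ((hasDerivAt_id y).fun_sub (Real.hasDerivAt_log hy.ne')).sub_const 1
  deriv_h y hy := ((hasDerivAt_inv hy.ne').const_sub 1).congr_deriv (by ring)
  cont_k := ContinuousOn.inv₀ (f := fun y : ℝ => y ^ 2) (by fun_prop)
    fun y hy => (pow_pos hy 2).ne'
  k_pos y hy := by positivity
  h_lt y hy := by linarith [inv_pos.2 hy]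
  H_nonneg y hy := sub_log_sub_one_nonneg hy
  H_le y hy := le_rfl

namespace MHDFlow

variable {α β T : ℝ}

/-- Bounds on unit intervals that follow from the entropy estimate. -/
structure LocalBound (F : MHDFlow α β T) (E : ℝ) : Prop where
  pos : 0 < E
  integral_u_sq_le : ∀ x, ∀ t ∈ Icc 0 T, ∫ y in x..(x + 1), F.u y t ^ 2 ≤ 2 * E
  integral_v_le : ∀ x, ∀ t ∈ Icc 0 T, ∫ y in x..(x + 1), F.v y t ≤ 2 * E + 2
  integral_θ_le : ∀ x, ∀ t ∈ Icc 0 T, ∫ y in x..(x + 1), F.θ y t ≤ 2 * E + 2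
  integral_v_mul_b_sq_le : ∀ x, ∀ t ∈ Icc 0 T,
    ∫ y in x..(x + 1), F.v y t * (F.b₁ y t ^ 2 + F.b₂ y t ^ 2) ≤ 2 * E
  integral_sub_logv_le : ∀ x, ∀ t ∈ Icc 0 T, ∫ y in x..(x + 1), (F.v y t - F.logv y t - 1) ≤ E
  integral_Hθ_le : ∀ A, 0 ≤ A → ∀ t ∈ Icc 0 T, ∫ y in (-A)..A, F.Hθ entropyRenorm y t ≤ E

theorem remainder_entropyRenorm (F : MHDFlow α β T) (x t : ℝ) :
    F.remainder entropyRenorm x t = 0 := by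
  have := F.θ_ne x t
  have h : (1 - F.hθ entropyRenorm x t) * F.θ x t - 1 = 0 := by
    simp only [hθ, entropyRenorm]
    field_simp
    ring
  simp [remainder, h]

theorem InitBound.localBound {F : MHDFlow α β T} {K δ : ℝ} (h : F.InitBound K δ) (hα : 0 ≤ α)
    (hT : 0 < T) (hK : 0 < K) (hδ : 0 < δ) (hδ₁ : δ ≤ 1) :
    F.LocalBound (2 * ((1 / δ + 1 + 2 * K) * K ^ 2 + 2 * T)) := by
  set E := 2 * ((1 / δ + 1 + 2 * K) * K ^ 2 + 2 * T) with hE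
  have hA : ∀ A, 0 ≤ A → ∀ t ∈ Icc 0 T, ∫ x in (-A)..A, F.energy entropyRenorm x t ≤ E := by
    intro A hA t ht
    have h1 := F.integral_energy_add_le hα entropyRenorm le_rfl
      (fun A hA => h.integral_energy_le hK hδ hδ₁ entropyRenorm hA)
      ⟨0, fun R hR s _ => by
        have : 0 ≤ ∫ x in (-R)..R, cutoff R x * F.dissHeat entropyRenorm x s :=
          intervalIntegral.integral_nonneg (by linarith [hR.le]) fun x _ =>
            mul_nonneg (cutoff_nonneg R x) (F.dissHeat_nonneg _ x s)
        simp only [F.remainder_entropyRenorm, mul_zero, intervalIntegral.integral_zero]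
        positivity⟩ hA ht
    have h2 : 0 ≤ ∫ s in (0:ℝ)..t, ∫ x in (-A)..A,
        (F.dissKin entropyRenorm x s + F.dissHeat entropyRenorm x s) :=
      intervalIntegral.integral_nonneg ht.1 fun s _ =>
        intervalIntegral.integral_nonneg (by linarith) fun x _ =>
          add_nonneg (F.dissKin_nonneg hα _ x s) (F.dissHeat_nonneg _ x s)
    rw [zero_add] at h1
    linarith
  have hJ : ∀ x, ∀ t ∈ Icc 0 T, ∫ y in x..(x + 1), F.energy entropyRenorm y t ≤ E :=
    fun x t ht => le_trans (integral_le_of_subinterval (by fun_prop)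
      (fun y => F.energy_nonneg _ y t) (by linarith [neg_abs_le x]) (by linarith)
      (by linarith [le_abs_self x])) (hA (|x| + 1) (by positivity) t ht)
  have hmain : ∀ (g : ℝ → ℝ → ℝ) (p q : ℝ), (∀ t, Continuous fun y => g y t) →
      (∀ y t, g y t ≤ p * F.energy entropyRenorm y t + q) → 0 ≤ p →
      ∀ x, ∀ t ∈ Icc 0 T, ∫ y in x..(x + 1), g y t ≤ p * E + q := by
    intro g p q hg hle hp x t ht
    have h1 : ∫ y in x..(x + 1), g y t
        ≤ ∫ y in x..(x + 1), (p * F.energy entropyRenorm y t + q) :=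
      intervalIntegral.integral_mono_on (by linarith) ((hg t).intervalIntegrable _ _)
        (Continuous.intervalIntegrable (by fun_prop) _ _) fun y _ => hle y t
    rw [intervalIntegral.integral_add (Continuous.intervalIntegrable (by fun_prop) _ _)
      (Continuous.intervalIntegrable (by fun_prop) _ _), intervalIntegral.integral_const_mul,
      intervalIntegral.integral_const, smul_eq_mul] at h1
    have := mul_le_mul_of_nonneg_left (hJ x t ht) hp
    linarith
  have parts : ∀ y t, 0 ≤ F.v y t - F.logv y t - 1 ∧ 0 ≤ F.Hθ entropyRenorm y t ∧
      0 ≤ F.v y t * (F.b₁ y t ^ 2 + F.b₂ y t ^ 2) ∧ F.v y t ≤ 2 * (F.v y t - F.logv y t - 1) + 2 ∧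
      F.θ y t ≤ 2 * F.Hθ entropyRenorm y t + 2 := fun y t =>
    ⟨sub_log_sub_one_nonneg (F.v_pos y t), entropyRenorm.H_nonneg _ (F.θ_pos y t),
      mul_nonneg (F.v_pos y t).le (by positivity), le_two_mul_sub_log_add_two (F.v_pos y t),
      le_two_mul_sub_log_add_two (F.θ_pos y t)⟩
  refine ⟨by positivity, fun x t ht => ?_, ?_, ?_, fun x t ht => ?_, fun x t ht => ?_,
    fun A hA0 t ht => ?_⟩
  · refine (hmain (fun y t => F.u y t ^ 2) 2 0 (fun t => by fun_prop) (fun y t => ?_) zero_le_two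
      x t ht).trans (by linarith)
    obtain ⟨p1, p2, p3, -, -⟩ := parts y t
    unfold MHDFlow.energy
    linarith [sq_nonneg (F.w₁ y t), sq_nonneg (F.w₂ y t)]
  · refine hmain F.v 2 2 (fun t => by fun_prop) (fun y t => ?_) zero_le_two
    obtain ⟨p1, p2, p3, p4, -⟩ := parts y t
    unfold MHDFlow.energy
    linarith [sq_nonneg (F.w₁ y t), sq_nonneg (F.w₂ y t), sq_nonneg (F.u y t)]
  · refine hmain F.θ 2 2 (fun t => by fun_prop) (fun y t => ?_) zero_le_two
    obtain ⟨p1, p2, p3, -, p5⟩ := parts y t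
    unfold MHDFlow.energy
    linarith [sq_nonneg (F.w₁ y t), sq_nonneg (F.w₂ y t), sq_nonneg (F.u y t)]
  · refine (hmain (fun y t => F.v y t * (F.b₁ y t ^ 2 + F.b₂ y t ^ 2)) 2 0
      (fun t => by fun_prop) (fun y t => ?_) zero_le_two x t ht).trans (by linarith)
    obtain ⟨p1, p2, p3, -, -⟩ := parts y t
    unfold MHDFlow.energy
    linarith [sq_nonneg (F.w₁ y t), sq_nonneg (F.w₂ y t), sq_nonneg (F.u y t)]
  · refine (hmain (fun y t => F.v y t - F.logv y t - 1) 1 0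
      (fun t => by fun_prop) (fun y t => ?_) zero_le_one x t ht).trans (by linarith)
    obtain ⟨p1, p2, p3, -, -⟩ := parts y t
    unfold MHDFlow.energy
    linarith [sq_nonneg (F.w₁ y t), sq_nonneg (F.w₂ y t), sq_nonneg (F.u y t)]
  · refine le_trans (intervalIntegral.integral_mono_on (by linarith)
      (Continuous.intervalIntegrable (by fun_prop) _ _)
      (Continuous.intervalIntegrable (by fun_prop) _ _) fun y _ => ?_) (hA A hA0 t ht)
    obtain ⟨p1, p2, p3, -, -⟩ := parts y t
    unfold MHDFlow.energy
    linarith [sq_nonneg (F.w₁ y t), sq_nonneg (F.w₂ y t), sq_nonneg (F.u y t)]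

end MHDFlow

/-! ### Lower bound for the specific volume -/

/-- Primitive of `visc α y / y`. -/
def viscPrim (α y : ℝ) : ℝ := Real.log y - y ^ (-α)

theorem hasDerivAt_viscPrim (α : ℝ) {y : ℝ} (hy : 0 < y) :
    HasDerivAt (viscPrim α) (visc α y / y) y := by
  refine ((Real.hasDerivAt_log hy.ne').fun_sub
    (Real.hasDerivAt_rpow_const (p := -α) (Or.inl hy.ne'))).congr_deriv ?_
  unfold visc
  rw [Real.rpow_sub_one hy.ne']
  field_simp
  ring

theorem continuousOn_viscPrim (α : ℝ) : ContinuousOn (viscPrim α) (Ioi 0) :=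
  fun _ hy => (hasDerivAt_viscPrim α hy).continuousAt.continuousWithinAt

theorem viscPrim_le_viscPrim {α : ℝ} (hα : 0 ≤ α) {y z : ℝ} (hy : 0 < y) (hyz : y ≤ z) :
    viscPrim α y ≤ viscPrim α z :=
  sub_le_sub (Real.log_le_log hy hyz)
    (Real.rpow_le_rpow_of_nonpos hy hyz (neg_nonpos.2 hα))

theorem exp_viscPrim_le (α : ℝ) {y : ℝ} (hy : 0 < y) : Real.exp (viscPrim α y) ≤ y := by
  calc Real.exp (viscPrim α y) ≤ Real.exp (Real.log y) := by
        apply Real.exp_le_exp.2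
        unfold viscPrim
        linarith [Real.rpow_pos_of_pos hy (-α)]
    _ = y := Real.exp_log hy

/-- The volume below which `y - log y - 1` exceeds `2E`. -/
def volumeFloor (E : ℝ) : ℝ := Real.exp (-(2 * E + 1))

theorem le_exp_viscPrim {α E : ℝ} (hα : 0 ≤ α) (hE : 0 < E) {y : ℝ} (hy : 0 < y) :
    Real.exp (viscPrim α (volumeFloor E)) * (1 - (y - Real.log y - 1) / (2 * E))
      ≤ Real.exp (viscPrim α y) := by
  have h0 := sub_log_sub_one_nonneg hy
  rcases le_total (volumeFloor E) y with h | h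
  · have h1 := Real.exp_le_exp.2 (viscPrim_le_viscPrim hα (Real.exp_pos _) h)
    refine le_trans (mul_le_of_le_one_right (Real.exp_pos _).le ?_) h1
    linarith [div_nonneg h0 (by positivity : 0 ≤ 2 * E)]
  · have h1 := Real.log_le_log hy h
    rw [volumeFloor, Real.log_exp] at h1
    have h2 : 1 ≤ (y - Real.log y - 1) / (2 * E) := by
      rw [le_div_iff₀ (by positivity)]
      linarith
    exact (mul_nonpos_of_nonneg_of_nonpos (Real.exp_pos _).le (by linarith)).trans
      (Real.exp_pos _).le

namespace MHDFlow

variable {α β T : ℝ}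

/-- The total pressure. -/
def pres (F : MHDFlow α β T) (x t : ℝ) : ℝ :=
  F.θ x t / F.v x t + (F.b₁ x t ^ 2 + F.b₂ x t ^ 2) / 2

/-- The time integral of the total pressure. -/
def presInt (F : MHDFlow α β T) (x t : ℝ) : ℝ := ∫ s in (0:ℝ)..t, F.pres x s

@[fun_prop]
theorem continuous_pres (F : MHDFlow α β T) {X : Type*} [TopologicalSpace X] {a c : X → ℝ}
    (ha : Continuous a) (hc : Continuous c) : Continuous fun x => F.pres (a x) (c x) := by
  unfold pres; fun_prop (disch := intros; exact F.v_ne _ _)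

@[fun_prop]
theorem continuous_presInt (F : MHDFlow α β T) {X : Type*} [TopologicalSpace X] {a c : X → ℝ}
    (ha : Continuous a) (hc : Continuous c) : Continuous fun x => F.presInt (a x) (c x) :=
  intervalIntegral.continuous_parametric_intervalIntegral_of_continuous
    (f := fun x s => F.pres (a x) s) (by fun_prop) hc

theorem pres_nonneg (F : MHDFlow α β T) (x t : ℝ) : 0 ≤ F.pres x t := by
  have := F.v_pos x t
  have := F.θ_pos x t
  unfold pres
  positivity

theorem presInt_nonneg (F : MHDFlow α β T) (x : ℝ) {t : ℝ} (ht : 0 ≤ t) : 0 ≤ F.presInt x t :=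
  intervalIntegral.integral_nonneg ht fun s _ => F.pres_nonneg x s

theorem hasDerivAt_presInt (F : MHDFlow α β T) (x t : ℝ) :
    HasDerivAt (fun s => F.presInt x s) (F.pres x t) t :=
  (Continuous.integral_hasStrictDerivAt (f := fun s => F.pres x s) (by fun_prop) 0 t).hasDerivAt

theorem viscPrim_sub_presInt (F : MHDFlow α β T) (x : ℝ) {t : ℝ} (ht : t ∈ Icc 0 T) :
    viscPrim α (F.v x t) - viscPrim α (F.v x 0) - F.presInt x t
      = ∫ s in (0:ℝ)..t, (F.vis x s * F.ux x s / F.v x s - F.pres x s) := by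
  have hc : Continuous fun s => F.vis x s * F.ux x s / F.v x s := by
    fun_prop (disch := intros; exact F.v_ne _ _)
  have h := intervalIntegral.integral_eq_sub_of_hasDerivAt_of_le ht.1
    (F.continuous_comp_v (continuousOn_viscPrim α) continuous_const continuous_id).continuousOn
    (f := fun s => viscPrim α (F.v x s)) (f' := fun s => F.vis x s * F.ux x s / F.v x s)
    (fun s hs => ((hasDerivAt_viscPrim α (F.v_pos x s)).comp s
      (F.dt_v x s ⟨hs.1, hs.2.trans_le ht.2⟩)).congr_deriv (by unfold vis; ring))
    (hc.intervalIntegrable _ _)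
  rw [intervalIntegral.integral_sub (hc.intervalIntegrable _ _)
    (Continuous.intervalIntegrable (by fun_prop) _ _), h, presInt]

theorem integral_u_sub (F : MHDFlow α β T) (x z : ℝ) {t : ℝ} (ht : t ∈ Icc 0 T) :
    (viscPrim α (F.v z t) - viscPrim α (F.v z 0) - F.presInt z t)
      - (viscPrim α (F.v x t) - viscPrim α (F.v x 0) - F.presInt x t)
      = (∫ y in x..z, F.u y t) - ∫ y in x..z, F.u y 0 := by
  have hc : ∀ y, Continuous fun s => F.vis y s * F.ux y s / F.v y s - F.pres y s := fun y => by
    fun_prop (disch := intros; exact F.v_ne _ _)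
  rw [F.viscPrim_sub_presInt x ht, F.viscPrim_sub_presInt z ht,
    ← intervalIntegral.integral_sub ((hc z).intervalIntegrable _ _)
      ((hc x).intervalIntegrable _ _)]
  have h := integral_mul_sub_eq_integral_integral (f := F.u) (ft := F.ut) (by fun_prop)
    (by fun_prop) (continuous_const (y := (1:ℝ))) F.dt_u ht x z
  simp only [one_mul] at h
  rw [h]
  refine intervalIntegral.integral_congr fun s _ => ?_
  exact (intervalIntegral.integral_eq_sub_of_hasDerivAt (fun y _ => F.eq_u y s)
    (Continuous.intervalIntegrable (by fun_prop) _ _)).symm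

namespace LocalBound

variable {F : MHDFlow α β T} {E : ℝ}

theorem abs_integral_u_le (h : F.LocalBound E) {x z t : ℝ} (hz : z ∈ Icc x (x + 1))
    (ht : t ∈ Icc 0 T) : |∫ y in x..z, F.u y t| ≤ 1 / 2 + E := by
  have hc : Continuous fun y => |F.u y t| := by fun_prop
  have hc' : Continuous fun y => 1 / 2 + F.u y t ^ 2 / 2 := by fun_prop
  calc |∫ y in x..z, F.u y t| ≤ ∫ y in x..z, |F.u y t| :=
        intervalIntegral.abs_integral_le_integral_abs hz.1
    _ ≤ ∫ y in x..(x + 1), |F.u y t| :=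
        integral_le_of_subinterval hc (fun _ => abs_nonneg _) le_rfl hz.1 hz.2
    _ ≤ ∫ y in x..(x + 1), (1 / 2 + F.u y t ^ 2 / 2) :=
        intervalIntegral.integral_mono_on (by linarith) (hc.intervalIntegrable _ _)
          (hc'.intervalIntegrable _ _) fun y _ => by
            nlinarith [sq_nonneg (|F.u y t| - 1), sq_abs (F.u y t)]
    _ ≤ 1 / 2 + E := by
        rw [intervalIntegral.integral_add (Continuous.intervalIntegrable (by fun_prop) _ _)
          (Continuous.intervalIntegrable (by fun_prop) _ _), intervalIntegral.integral_const,
          intervalIntegral.integral_div, smul_eq_mul]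
        linarith [h.integral_u_sq_le x t ht]

end LocalBound

/-- The oscillation constant of the momentum potential on unit intervals. -/
def oscBound (α E K δ : ℝ) : ℝ := 1 + 2 * E + (viscPrim α (1 + 2 * K) - viscPrim α δ)

/-- The constant converting between the local and averaged pressure exponentials. -/
def expBound (α E K δ : ℝ) : ℝ :=
  2 * Real.exp (oscBound α E K δ) / Real.exp (viscPrim α (volumeFloor E))

/-- A lower bound for the specific volume. -/
def volumeLower (α E K δ T : ℝ) : ℝ :=
  1 / (expBound α E K δ * Real.exp (Real.exp (oscBound α E K δ) * (3 * E + 2)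
    * expBound α E K δ * T))

theorem expBound_pos (α E K δ : ℝ) : 0 < expBound α E K δ := by
  unfold expBound; positivity

theorem volumeLower_pos (α E K δ T : ℝ) : 0 < volumeLower α E K δ T := by
  have := expBound_pos α E K δ
  unfold volumeLower; positivity

theorem LocalBound.volumeLower_le {F : MHDFlow α β T} {E K δ : ℝ} (h : F.LocalBound E)
    (hI : F.InitBound K δ) (hα : 0 ≤ α) (hδ : 0 < δ) (x : ℝ) {t : ℝ} (ht : t ∈ Icc 0 T) :
    volumeLower α E K δ T ≤ F.v x t := by
  set L := oscBound α E K δ with hL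
  set D := expBound α E K δ with hD
  have hE := h.pos
  have hD0 : 0 < D := expBound_pos _ _ _ _
  set q : ℝ → ℝ := fun s => viscPrim α (F.v x s) - F.presInt x s with hq
  have hosc : ∀ z ∈ Icc x (x + 1), ∀ s ∈ Icc 0 T,
      |viscPrim α (F.v z s) - F.presInt z s - q s| ≤ L := by
    intro z hz s hs
    have e := F.integral_u_sub x z hs
    have h1 := abs_le.1 (h.abs_integral_u_le hz hs)
    have h2 := abs_le.1 (h.abs_integral_u_le hz ⟨le_rfl, hs.1.trans hs.2⟩)
    have m1 : ∀ y, viscPrim α δ ≤ viscPrim α (F.v y 0) := fun y =>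
      viscPrim_le_viscPrim hα hδ (hI.v_ge y)
    have m2 : ∀ y, viscPrim α (F.v y 0) ≤ viscPrim α (1 + 2 * K) := fun y =>
      viscPrim_le_viscPrim hα (F.v_pos y 0) (hI.v_le y)
    have := m1 x
    have := m1 z
    have := m2 x
    have := m2 z
    rw [hL, oscBound, abs_le]
    constructor <;> simp only [hq] <;> linarith
  set N : ℝ → ℝ := fun s => ∫ z in x..(x + 1), Real.exp (F.presInt z s) with hN
  have hNc : Continuous N := continuous_intervalIntegral_left
    (f := fun z s => Real.exp (F.presInt z s)) (by fun_prop) _ _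
  have hlow : ∀ s ∈ Icc 0 T, Real.exp (-q s) ≤ D * N s := by
    intro s hs
    set m := Real.exp (viscPrim α (volumeFloor E)) with hm
    have hm0 : 0 < m := Real.exp_pos _
    have h1 : ∫ z in x..(x + 1), Real.exp (-L - q s)
          * (m * (1 - (F.v z s - F.logv z s - 1) / (2 * E))) ≤ N s := by
      refine intervalIntegral.integral_mono_on (by linarith)
        (Continuous.intervalIntegrable (by fun_prop) _ _)
        (Continuous.intervalIntegrable (by fun_prop) _ _) fun z hz => ?_
      calc Real.exp (-L - q s) * (m * (1 - (F.v z s - F.logv z s - 1) / (2 * E)))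
          ≤ Real.exp (-L - q s) * Real.exp (viscPrim α (F.v z s)) := by
            gcongr
            exact le_exp_viscPrim hα hE (F.v_pos z s)
        _ ≤ Real.exp (F.presInt z s) := by
            rw [← Real.exp_add]
            apply Real.exp_le_exp.2
            linarith [(abs_le.1 (hosc z hz s hs)).2]
    have h2 : 1 / 2 ≤ ∫ z in x..(x + 1), (1 - (F.v z s - F.logv z s - 1) / (2 * E)) := by
      rw [intervalIntegral.integral_sub (Continuous.intervalIntegrable (by fun_prop) _ _)
        (Continuous.intervalIntegrable (by fun_prop) _ _), intervalIntegral.integral_div,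
        intervalIntegral.integral_const, smul_eq_mul]
      have := h.integral_sub_logv_le x s hs
      have : (∫ z in x..(x + 1), (F.v z s - F.logv z s - 1)) / (2 * E) ≤ 1 / 2 := by
        rw [div_le_iff₀ (by positivity)]
        linarith
      linarith
    rw [intervalIntegral.integral_const_mul, intervalIntegral.integral_const_mul] at h1
    have h3 : Real.exp (-L - q s) * (m * (1 / 2)) ≤ N s := le_trans (by gcongr) h1
    have h4 : Real.exp (-q s) = D * (Real.exp (-L - q s) * (m * (1 / 2))) := by
      rw [hD, expBound, ← hL, ← hm, show -L - q s = -q s - L by ring, Real.exp_sub]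
      field_simp
    rw [h4]
    gcongr
  have hup : ∀ s ∈ Icc 0 T, N s ≤ 1 + Real.exp L * (3 * E + 2) * D * ∫ r in (0:ℝ)..s, N r := by
    intro s hs
    have e := integral_mul_sub_eq_integral_integral (f := fun z r => Real.exp (F.presInt z r))
      (ft := fun z r => Real.exp (F.presInt z r) * F.pres z r) (T := T) (by fun_prop)
      (by fun_prop) (continuous_const (y := (1:ℝ)))
      (fun z r _ => (F.hasDerivAt_presInt z r).exp) hs x (x + 1)
    have e0 : ∀ z, F.presInt z 0 = 0 := fun z => intervalIntegral.integral_same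
    simp only [one_mul, e0, Real.exp_zero, intervalIntegral.integral_const, smul_eq_mul] at e
    have h1 : ∫ r in (0:ℝ)..s, ∫ z in x..(x + 1), Real.exp (F.presInt z r) * F.pres z r
        ≤ ∫ r in (0:ℝ)..s, Real.exp L * (3 * E + 2) * D * N r := by
      refine intervalIntegral.integral_mono_on hs.1
        ((continuous_intervalIntegral_left
          (f := fun z r => Real.exp (F.presInt z r) * F.pres z r)
          (by fun_prop) _ _).intervalIntegrable _ _)
        ((hNc.const_mul _).intervalIntegrable _ _) fun r hr => ?_
      have hr' : r ∈ Icc 0 T := ⟨hr.1, hr.2.trans hs.2⟩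
      have h2 : ∫ z in x..(x + 1), Real.exp (F.presInt z r) * F.pres z r
          ≤ ∫ z in x..(x + 1), Real.exp (L - q r)
            * (F.θ z r + F.v z r * (F.b₁ z r ^ 2 + F.b₂ z r ^ 2) / 2) := by
        refine intervalIntegral.integral_mono_on (by linarith)
          (Continuous.intervalIntegrable (by fun_prop) _ _)
          (Continuous.intervalIntegrable (by fun_prop) _ _) fun z hz => ?_
        have hp := F.pres_nonneg z r
        have hv := F.v_pos z r
        calc Real.exp (F.presInt z r) * F.pres z r
            ≤ Real.exp (L - q r + viscPrim α (F.v z r)) * F.pres z r := by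
              gcongr
              linarith [(abs_le.1 (hosc z hz r hr')).1]
          _ ≤ Real.exp (L - q r) * F.v z r * F.pres z r := by
              rw [Real.exp_add]
              gcongr
              exact exp_viscPrim_le α hv
          _ = Real.exp (L - q r)
            * (F.θ z r + F.v z r * (F.b₁ z r ^ 2 + F.b₂ z r ^ 2) / 2) := by
              unfold pres
              field_simp
      rw [intervalIntegral.integral_const_mul, intervalIntegral.integral_add
        (Continuous.intervalIntegrable (by fun_prop) _ _)
        (Continuous.intervalIntegrable (by fun_prop) _ _), intervalIntegral.integral_div] at h2
      have h3 := h.integral_θ_le x r hr'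
      have h4 := h.integral_v_mul_b_sq_le x r hr'
      calc ∫ z in x..(x + 1), Real.exp (F.presInt z r) * F.pres z r
          ≤ Real.exp (L - q r) * (3 * E + 2) := h2.trans
            (mul_le_mul_of_nonneg_left (by linarith) (Real.exp_pos _).le)
        _ = Real.exp L * (3 * E + 2) * Real.exp (-q r) := by
            rw [sub_eq_add_neg, Real.exp_add]; ring
        _ ≤ Real.exp L * (3 * E + 2) * (D * N r) := by gcongr; exact hlow r hr'
        _ = Real.exp L * (3 * E + 2) * D * N r := by ring
    rw [intervalIntegral.integral_const_mul] at h1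
    linarith
  have hgr := le_mul_exp_of_le_add_integral hNc (by positivity) hup t ht
  have h1 : Real.exp (-q t) ≤ D * Real.exp (Real.exp L * (3 * E + 2) * D * T) := by
    refine (hlow t ht).trans ?_
    gcongr
    refine hgr.trans ?_
    rw [one_mul]
    gcongr
    exact ht.2
  calc volumeLower α E K δ T ≤ 1 / Real.exp (-q t) := by
        unfold volumeLower
        exact one_div_le_one_div_of_le (Real.exp_pos _) h1
    _ = Real.exp (q t) := by rw [Real.exp_neg, one_div, inv_inv]
    _ ≤ Real.exp (viscPrim α (F.v x t)) := by
        apply Real.exp_le_exp.2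
        simp only [hq]
        linarith [F.presInt_nonneg x ht.1]
    _ ≤ F.v x t := exp_viscPrim_le α (F.v_pos x t)

end MHDFlow

/-! ### The estimate for the renormalization by `(√θ - 1)²` -/

/-- The renormalization by `(√θ - 1)²`. -/
def sqrtRenorm : Renorm where
  H y := (√y - 1) ^ 2
  h y := 1 - (√y)⁻¹
  k y := (2 * (y * √y))⁻¹
  deriv_H y hy := by
    have hs := Real.sqrt_pos.2 hy
    refine (((Real.hasDerivAt_sqrt hy.ne').sub_const 1).fun_pow 2).congr_deriv ?_
    field_simp
    push_cast
    ring
  deriv_h y hy := by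
    have hs := Real.sqrt_pos.2 hy
    refine (((Real.hasDerivAt_sqrt hy.ne').fun_inv hs.ne').const_sub 1).congr_deriv ?_
    rw [Real.sq_sqrt hy.le]
    field_simp
  cont_k := ContinuousOn.inv₀ (f := fun y : ℝ => 2 * (y * √y)) (by fun_prop) fun y hy => by
    have := Real.sqrt_pos.2 hy
    have : 0 < y := hy
    positivity
  k_pos y hy := by
    have := Real.sqrt_pos.2 hy
    positivity
  h_lt y hy := by linarith [inv_pos.2 (Real.sqrt_pos.2 hy)]
  H_nonneg y hy := sq_nonneg _
  H_le y hy := sqrt_sub_one_sq_le hy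

namespace MHDFlow

variable {α β T : ℝ}

theorem one_sub_hθ_sqrtRenorm (F : MHDFlow α β T) (x t : ℝ) :
    1 - F.hθ sqrtRenorm x t = (√(F.θ x t))⁻¹ := by
  simp [hθ, sqrtRenorm]

theorem remainder_sqrtRenorm (F : MHDFlow α β T) (x t : ℝ) :
    F.remainder sqrtRenorm x t = √(F.θ x t) * (√(F.θ x t) - 1) ^ 2 / F.v x t := by
  have hθ := F.θ_pos x t
  have hs := Real.sqrt_pos.2 hθ
  have hv := F.v_pos x t
  have e : (√(F.θ x t))⁻¹ * F.θ x t = √(F.θ x t) := by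
    rw [inv_mul_eq_div, Real.div_sqrt]
  rw [remainder, F.one_sub_hθ_sqrtRenorm, e]
  field_simp

theorem sq_rpow_deriv_eq (F : MHDFlow α β T) (x t : ℝ) :
    (F.θx x t * (β / 2 + 1 / 4) * F.θ x t ^ (β / 2 + 1 / 4 - 1)) ^ 2
      = F.dissHeat sqrtRenorm x t * (2 * (β / 2 + 1 / 4) ^ 2 * F.v x t) := by
  have hθ := F.θ_pos x t
  have hv := F.v_pos x t
  have hs := Real.sqrt_pos.2 hθ
  have e : (F.θ x t ^ (β / 2 + 1 / 4 - 1)) ^ 2 * (F.θ x t * √(F.θ x t)) = F.θ x t ^ β := by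
    rw [← Real.rpow_mul_natCast hθ.le, Real.sqrt_eq_rpow]
    nth_rewrite 2 [← Real.rpow_one (F.θ x t)]
    rw [← Real.rpow_add hθ, ← Real.rpow_add hθ]
    congr 1
    push_cast
    ring
  have e2 : (F.θ x t ^ (β / 2 + 1 / 4 - 1)) ^ 2 = F.θ x t ^ β / (F.θ x t * √(F.θ x t)) := by
    rw [← e]; field_simp
  rw [mul_pow, mul_pow, e2]
  simp only [dissHeat, kθ, kap, sqrtRenorm]
  field_simp

theorem LocalBound.rpow_θ_le {F : MHDFlow α β T} {E : ℝ} (h : F.LocalBound E) (hβ : 0 < β)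
    (x : ℝ) {t : ℝ} (ht : t ∈ Icc 0 T) :
    F.θ x t ^ (β + 1 / 2) ≤ 2 * (2 * E + 2) ^ (β + 1 / 2)
      + 4 * (β / 2 + 1 / 4) ^ 2 * (2 * E + 2) * ∫ y in x..(x + 1), F.dissHeat sqrtRenorm y t := by
  set γ := β / 2 + 1 / 4 with hγ
  have hγ0 : 0 < γ := by positivity
  have hE := h.pos
  obtain ⟨y, hy, hyE⟩ := exists_le_of_integral_le (f := fun y => F.θ y t) (by fun_prop)
    (h.integral_θ_le x t ht)
  set D := ∫ y in x..(x + 1), F.dissHeat sqrtRenorm y t with hD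
  have hd : ∀ z, HasDerivAt (fun z => F.θ z t ^ γ) (F.θx z t * γ * F.θ z t ^ (γ - 1)) z :=
    fun z => (F.dx_θ z t).rpow_const (Or.inl (F.θ_ne z t))
  have hc : Continuous fun z => F.θx z t * γ * F.θ z t ^ (γ - 1) := by
    have := F.continuous_comp_θ (g := fun y => y ^ (γ - 1))
      (continuousOn_id.rpow_const fun _ hy => Or.inl (ne_of_gt hy))
      continuous_id (continuous_const (y := t))
    fun_prop
  set I := ∫ z in x..(x + 1), |F.θx z t * γ * F.θ z t ^ (γ - 1)| with hI
  have h1 : F.θ x t ^ γ ≤ (2 * E + 2) ^ γ + I := by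
    have e := intervalIntegral.integral_eq_sub_of_hasDerivAt (a := x) (b := y)
      (fun z _ => hd z) (hc.intervalIntegrable _ _)
    have e1 := (abs_le.1 (intervalIntegral.abs_integral_le_integral_abs (μ := volume)
      (f := fun z => F.θx z t * γ * F.θ z t ^ (γ - 1)) hy.1)).1
    have e2 : ∫ z in x..y, |F.θx z t * γ * F.θ z t ^ (γ - 1)| ≤ I :=
      integral_le_of_subinterval hc.abs (fun _ => abs_nonneg _) le_rfl hy.1 hy.2
    have e3 : F.θ y t ^ γ ≤ (2 * E + 2) ^ γ :=
      Real.rpow_le_rpow (F.θ_pos y t).le hyE hγ0.le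
    linarith
  have h2 : ∀ l > 0, 2 * I ≤ l * D + (2 * γ ^ 2 * (2 * E + 2)) / l := by
    intro l hl
    have e : ∫ z in x..(x + 1), 2 * |F.θx z t * γ * F.θ z t ^ (γ - 1)|
        ≤ ∫ z in x..(x + 1), (l * F.dissHeat sqrtRenorm z t + 2 * γ ^ 2 / l * F.v z t) := by
      refine intervalIntegral.integral_mono_on (by linarith)
        ((hc.abs.const_mul 2).intervalIntegrable _ _)
        (Continuous.intervalIntegrable (by fun_prop) _ _) fun z _ => ?_
      have hD0 := F.dissHeat_nonneg sqrtRenorm z t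
      have hv := F.v_pos z t
      rw [show 2 * |F.θx z t * γ * F.θ z t ^ (γ - 1)| = |2 * (F.θx z t * γ * F.θ z t ^ (γ - 1))| by
        rw [abs_mul 2, abs_two]]
      refine abs_le_of_sq_le_sq ?_ (by positivity)
      rw [mul_pow, F.sq_rpow_deriv_eq z t, ← hγ]
      have e4 : F.dissHeat sqrtRenorm z t * (2 * γ ^ 2 * F.v z t)
          = (l * F.dissHeat sqrtRenorm z t) * (2 * γ ^ 2 / l * F.v z t) := by field_simp
      rw [e4]
      nlinarith [sq_nonneg (l * F.dissHeat sqrtRenorm z t - 2 * γ ^ 2 / l * F.v z t)]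
    rw [intervalIntegral.integral_const_mul, intervalIntegral.integral_add
      (Continuous.intervalIntegrable (by fun_prop) _ _)
      (Continuous.intervalIntegrable (by fun_prop) _ _), intervalIntegral.integral_const_mul,
      intervalIntegral.integral_const_mul] at e
    have e5 : 2 * γ ^ 2 / l * ∫ z in x..(x + 1), F.v z t ≤ 2 * γ ^ 2 / l * (2 * E + 2) := by
      gcongr
      exact h.integral_v_le x t ht
    rw [div_mul_eq_mul_div, div_mul_eq_mul_div] at e5
    rw [div_mul_eq_mul_div] at e
    linarith
  have hI0 : 0 ≤ I := intervalIntegral.integral_nonneg (by linarith) fun _ _ => abs_nonneg _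
  have hD0 : 0 ≤ D := intervalIntegral.integral_nonneg (by linarith)
    fun z _ => F.dissHeat_nonneg sqrtRenorm z t
  have h3 : I ^ 2 ≤ D * (2 * γ ^ 2 * (2 * E + 2)) := by
    rcases hI0.eq_or_lt with h0 | h0
    · rw [← h0, zero_pow two_ne_zero]
      positivity
    · exact sq_le_mul_of_forall_two_mul_le h0 (by positivity) h2
  have e6 : ∀ y : ℝ, 0 ≤ y → y ^ (β + 1 / 2) = (y ^ γ) ^ 2 := fun y hy => by
    rw [← Real.rpow_mul_natCast hy]
    congr 1
    rw [hγ]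
    push_cast
    ring
  rw [e6 _ (F.θ_pos x t).le, e6 _ (by positivity)]
  have h4 : (F.θ x t ^ γ) ^ 2 ≤ ((2 * E + 2) ^ γ + I) ^ 2 := by
    have := Real.rpow_nonneg (F.θ_pos x t).le γ
    gcongr
  nlinarith [sq_nonneg ((2 * E + 2) ^ γ - I)]

theorem exists_sqrt_θ_le (hβ : 0 < β) {E ε : ℝ} (hE : 0 < E) (hε : 0 < ε) :
    ∃ C > 0, ∀ (α T : ℝ) (F : MHDFlow α β T), F.LocalBound E → ∀ x, ∀ t ∈ Icc 0 T,
      √(F.θ x t) ≤ C + ε * ∫ y in x..(x + 1), F.dissHeat sqrtRenorm y t := by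
  set p := 4 * (β / 2 + 1 / 4) ^ 2 * (2 * E + 2) with hp
  have hp0 : 0 < p := by positivity
  obtain ⟨C, hC, h⟩ := exists_sqrt_le_rpow hβ (div_pos hε hp0)
  refine ⟨C + ε / p * (2 * (2 * E + 2) ^ (β + 1 / 2)), by positivity, fun α T F hF x t ht => ?_⟩
  have h1 := h _ (F.θ_pos x t)
  have h2 := mul_le_mul_of_nonneg_left (hF.rpow_θ_le hβ x ht) (div_pos hε hp0).le
  rw [← hp, mul_add, ← mul_assoc (ε / p) p, div_mul_cancel₀ ε hp0.ne'] at h2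
  linarith

theorem exists_far (F : MHDFlow α β T) : ∃ A > 0, ∀ x t, A ≤ |x| →
    F.θ x t ≤ 2 ∧ F.b₁ x t ^ 2 + F.b₂ x t ^ 2 ≤ 1 := by
  obtain ⟨A, hA⟩ := F.far (1 / 2) (by norm_num)
  refine ⟨max A 1, by positivity, fun x t hx => ?_⟩
  obtain ⟨-, -, h3, -, -, h6, h7⟩ := hA x t ((le_max_left _ _).trans hx)
  rw [abs_lt] at h3 h6 h7
  constructor <;> nlinarith

theorem sqrt_θ_le_of_far {F : MHDFlow α β T} {C ε A₀ A t : ℝ} (hC : 0 < C) (hε : 0 < ε)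
    (hfar : ∀ x t, A₀ ≤ |x| → F.θ x t ≤ 2 ∧ F.b₁ x t ^ 2 + F.b₂ x t ^ 2 ≤ 1) (hA₀ : 0 < A₀)
    (hA : A₀ + 1 ≤ A)
    (h : ∀ x, √(F.θ x t) ≤ C + ε * ∫ y in x..(x + 1), F.dissHeat sqrtRenorm y t) (x : ℝ) :
    √(F.θ x t) ≤ C + 2 + ε * ∫ y in (-A)..A, F.dissHeat sqrtRenorm y t := by
  rcases le_total A₀ |x| with hx | hx
  · have h1 : √(F.θ x t) ≤ 2 := by
      rw [Real.sqrt_le_left zero_le_two]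
      linarith [(hfar x t hx).1]
    have h2 : 0 ≤ ∫ y in (-A)..A, F.dissHeat sqrtRenorm y t :=
      intervalIntegral.integral_nonneg (by linarith) fun y _ => F.dissHeat_nonneg _ y t
    have := mul_nonneg hε.le h2
    linarith
  · have hx' := abs_le.1 hx
    have h1 : ∫ y in x..(x + 1), F.dissHeat sqrtRenorm y t
        ≤ ∫ y in (-A)..A, F.dissHeat sqrtRenorm y t :=
      integral_le_of_subinterval (by fun_prop) (fun y => F.dissHeat_nonneg _ y t)
        (by linarith) (by linarith) (by linarith)
    have := mul_le_mul_of_nonneg_left h1 hε.le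
    linarith [h x]

/-- Control of the pressure remainder by a fraction of the thermal dissipation. -/
theorem LocalBound.integral_remainder_le {F : MHDFlow α β T} {E C c A R t : ℝ}
    (h : F.LocalBound E) (hc : 0 < c) (hv : ∀ x, c ≤ F.v x t) (ht : t ∈ Icc 0 T) (hA : 0 < A)
    (hAR : 2 * A ≤ R) (hC : 0 < C)
    (hs : ∀ x, √(F.θ x t) ≤ C + c / (8 * E) * ∫ y in (-A)..A, F.dissHeat sqrtRenorm y t) :
    ∫ x in (-R)..R, cutoff R x * F.remainder sqrtRenorm x t
      ≤ C * E / c + (∫ x in (-R)..R, cutoff R x * F.dissHeat sqrtRenorm x t) / 4 := by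
  have hE := h.pos
  have hR : 0 < R := by linarith
  set D := ∫ x in (-R)..R, cutoff R x * F.dissHeat sqrtRenorm x t with hD
  have hD0 : 0 ≤ D := intervalIntegral.integral_nonneg (by linarith) fun x _ =>
    mul_nonneg (cutoff_nonneg R x) (F.dissHeat_nonneg _ x t)
  have h1 : ∫ y in (-A)..A, F.dissHeat sqrtRenorm y t ≤ 2 * D :=
    integral_le_two_mul_integral_cutoff (by fun_prop) (fun x => F.dissHeat_nonneg _ x t)
      hA.le hR hAR
  set S := C + c / (8 * E) * (2 * D) with hS
  have hS' : ∀ x, √(F.θ x t) ≤ S := fun x => (hs x).trans (by rw [hS]; gcongr)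
  have h2 : ∫ x in (-R)..R, cutoff R x * F.remainder sqrtRenorm x t
      ≤ ∫ x in (-R)..R, S / c * F.Hθ entropyRenorm x t := by
    refine intervalIntegral.integral_mono_on (by linarith)
      (Continuous.intervalIntegrable (by fun_prop) _ _)
      (Continuous.intervalIntegrable (by fun_prop) _ _) fun x hx => ?_
    have hH : (√(F.θ x t) - 1) ^ 2 ≤ F.Hθ entropyRenorm x t := sqrt_sub_one_sq_le (F.θ_pos x t)
    calc cutoff R x * F.remainder sqrtRenorm x t ≤ F.remainder sqrtRenorm x t :=
          mul_le_of_le_one_left (F.remainder_nonneg _ x t) (cutoff_le_one hx)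
      _ = √(F.θ x t) * (√(F.θ x t) - 1) ^ 2 / F.v x t := F.remainder_sqrtRenorm x t
      _ ≤ S * F.Hθ entropyRenorm x t / c := by
          have : 0 ≤ S := by positivity
          have := (sq_nonneg _).trans hH
          gcongr
          · exact hS' x
          · exact hv x
      _ = S / c * F.Hθ entropyRenorm x t := by ring
  rw [intervalIntegral.integral_const_mul] at h2
  have h3 : S / c * ∫ x in (-R)..R, F.Hθ entropyRenorm x t ≤ S / c * E := by
    gcongr
    exact h.integral_Hθ_le R hR.le t ht
  have h4 : S / c * E = C * E / c + D / 4 := by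
    rw [hS]; field_simp; ring
  linarith

end MHDFlow

/-! ### The time integral of the supremum of the magnetic field -/

namespace MHDFlow

variable {α β T : ℝ}

theorem abs_two_mul_b_mul_bx_le (F : MHDFlow α β T) (hα : 0 ≤ α) {x t S : ℝ}
    (hS : √(F.θ x t) ≤ S) :
    |2 * F.b₁ x t * F.b₁x x t + 2 * F.b₂ x t * F.b₂x x t|
      ≤ F.dissKin sqrtRenorm x t + S * (F.v x t * (F.b₁ x t ^ 2 + F.b₂ x t ^ 2)) := by
  have hs := Real.sqrt_pos.2 (F.θ_pos x t)
  have hv := F.v_pos x t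
  have hvis : 0 ≤ F.vis x t := zero_le_one.trans (one_le_visc hα hv)
  have h1 : (F.b₁x x t ^ 2 + F.b₂x x t ^ 2) / (√(F.θ x t) * F.v x t)
      ≤ F.dissKin sqrtRenorm x t := by
    rw [dissKin, F.one_sub_hθ_sqrtRenorm, inv_mul_eq_div, div_div, mul_comm (F.v x t)]
    exact div_le_div_of_nonneg_right (le_add_of_nonneg_left (by positivity)) (by positivity)
  have h2 := mul_le_mul_of_nonneg_right hS
    (by positivity : 0 ≤ F.v x t * (F.b₁ x t ^ 2 + F.b₂ x t ^ 2))
  set q := √(F.θ x t) * F.v x t with hq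
  have hq0 : 0 < q := by positivity
  have young : ∀ y z : ℝ, |2 * y * z| ≤ z ^ 2 / q + q * y ^ 2 := fun y z => by
    have e : z ^ 2 / q + q * y ^ 2 - 2 * (|y| * |z|) = (|z| - q * |y|) ^ 2 / q := by
      rw [← sq_abs z, ← sq_abs y]
      field_simp
      ring
    have := div_nonneg (sq_nonneg (|z| - q * |y|)) hq0.le
    rw [abs_mul, abs_mul, abs_two]
    linarith
  have e : (F.b₁x x t ^ 2 + F.b₂x x t ^ 2) / q = F.b₁x x t ^ 2 / q + F.b₂x x t ^ 2 / q :=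
    add_div _ _ _
  have := abs_add_le (2 * F.b₁ x t * F.b₁x x t) (2 * F.b₂ x t * F.b₂x x t)
  have := young (F.b₁ x t) (F.b₁x x t)
  have := young (F.b₂ x t) (F.b₂x x t)
  have : √(F.θ x t) * (F.v x t * (F.b₁ x t ^ 2 + F.b₂ x t ^ 2))
      = q * F.b₁ x t ^ 2 + q * F.b₂ x t ^ 2 := by rw [hq]; ring
  linarith

theorem LocalBound.b_sq_le {F : MHDFlow α β T} {E c S t : ℝ} (h : F.LocalBound E) (hα : 0 ≤ α)
    (hc : 0 < c) (hv : ∀ x, c ≤ F.v x t) (ht : t ∈ Icc 0 T) (hS : ∀ x, √(F.θ x t) ≤ S) (x : ℝ) :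
    F.b₁ x t ^ 2 + F.b₂ x t ^ 2
      ≤ 2 * E / c + 2 * E * S + ∫ y in x..(x + 1), F.dissKin sqrtRenorm y t := by
  have hS0 : 0 ≤ S := (Real.sqrt_nonneg _).trans (hS x)
  obtain ⟨y, hy, hyE⟩ := exists_le_of_integral_le
    (f := fun y => F.v y t * (F.b₁ y t ^ 2 + F.b₂ y t ^ 2)) (by fun_prop)
    (h.integral_v_mul_b_sq_le x t ht)
  have h1 : F.b₁ y t ^ 2 + F.b₂ y t ^ 2 ≤ 2 * E / c := by
    rw [le_div_iff₀ hc, mul_comm]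
    exact (mul_le_mul_of_nonneg_right (hv y) (by positivity)).trans hyE
  have hd : ∀ z, HasDerivAt (fun z => F.b₁ z t ^ 2 + F.b₂ z t ^ 2)
      (2 * F.b₁ z t * F.b₁x z t + 2 * F.b₂ z t * F.b₂x z t) z := fun z =>
    (((F.dx_b₁ z t).fun_pow 2).fun_add ((F.dx_b₂ z t).fun_pow 2)).congr_deriv (by simp)
  have hcont : Continuous fun z => 2 * F.b₁ z t * F.b₁x z t + 2 * F.b₂ z t * F.b₂x z t := by
    fun_prop
  have e := intervalIntegral.integral_eq_sub_of_hasDerivAt (a := x) (b := y)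
    (fun z _ => hd z) (hcont.intervalIntegrable _ _)
  have e1 := (abs_le.1 (intervalIntegral.abs_integral_le_integral_abs (μ := volume)
    (f := fun z => 2 * F.b₁ z t * F.b₁x z t + 2 * F.b₂ z t * F.b₂x z t) hy.1)).1
  have e2 := integral_le_of_subinterval (a := x) (b := y) (c := x) (d := x + 1)
    hcont.abs (fun _ => abs_nonneg _) le_rfl hy.1 hy.2
  have e3 : ∫ z in x..(x + 1), |2 * F.b₁ z t * F.b₁x z t + 2 * F.b₂ z t * F.b₂x z t|
      ≤ ∫ z in x..(x + 1), (F.dissKin sqrtRenorm z t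
        + S * (F.v z t * (F.b₁ z t ^ 2 + F.b₂ z t ^ 2))) :=
    intervalIntegral.integral_mono_on (by linarith) (hcont.abs.intervalIntegrable _ _)
      (Continuous.intervalIntegrable (by fun_prop) _ _)
      fun z _ => F.abs_two_mul_b_mul_bx_le hα (hS z)
  rw [intervalIntegral.integral_add (Continuous.intervalIntegrable (by fun_prop) _ _)
    (Continuous.intervalIntegrable (by fun_prop) _ _), intervalIntegral.integral_const_mul] at e3
  have e4 := mul_le_mul_of_nonneg_left (h.integral_v_mul_b_sq_le x t ht) hS0
  linarith

/-- The bound for the square-root renormalization, in the form of a pointwise bound for the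
magnetic field by a function with controlled time integral. -/
theorem LocalBound.exists_b_sq_le {F : MHDFlow α β T} {K δ E c C : ℝ} (h : F.LocalBound E)
    (hα : 0 ≤ α) (hT : 0 < T) (hI : F.InitBound K δ) (hK : 0 < K) (hδ : 0 < δ) (hδ₁ : δ ≤ 1)
    (hc : 0 < c) (hv : ∀ x, ∀ t ∈ Icc 0 T, c ≤ F.v x t) (hC : 0 < C)
    (hs : ∀ x, ∀ t ∈ Icc 0 T,
      √(F.θ x t) ≤ C + c / (8 * E) * ∫ y in x..(x + 1), F.dissHeat sqrtRenorm y t) :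
    ∃ D : ℝ → ℝ, Continuous D ∧
      (∀ x, ∀ t ∈ Icc 0 T, F.b₁ x t ^ 2 + F.b₂ x t ^ 2
        ≤ 2 * E / c + 2 * E * (C + 2) + 1 + (c / 4 + 1) * D t) ∧
      ∫ s in (0:ℝ)..T, D s ≤ 4 * ((1 / δ + 1 + 2 * K) * K ^ 2 + ((C + 2) * E / c + 2) * T) := by
  have hE := h.pos
  obtain ⟨A₀, hA₀, hfar⟩ := F.exists_far
  set A := A₀ + 1 with hA
  have hA0 : 0 < A := by linarith
  have hε : 0 < c / (8 * E) := by positivity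
  have hs' : ∀ t ∈ Icc 0 T, ∀ x, √(F.θ x t)
      ≤ C + 2 + c / (8 * E) * ∫ y in (-A)..A, F.dissHeat sqrtRenorm y t := fun t ht x =>
    sqrt_θ_le_of_far hC hε hfar hA₀ le_rfl (fun x => hs x t ht) x
  refine ⟨fun s => ∫ x in (-A)..A, (F.dissKin sqrtRenorm x s + F.dissHeat sqrtRenorm x s),
    continuous_intervalIntegral_left (by fun_prop) _ _, fun x t ht => ?_, ?_⟩
  · have hH0 : 0 ≤ ∫ y in (-A)..A, F.dissHeat sqrtRenorm y t :=
      intervalIntegral.integral_nonneg (by linarith) fun y _ => F.dissHeat_nonneg _ y t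
    have hK0 : 0 ≤ ∫ y in (-A)..A, F.dissKin sqrtRenorm y t :=
      intervalIntegral.integral_nonneg (by linarith) fun y _ => F.dissKin_nonneg hα _ y t
    beta_reduce
    rw [intervalIntegral.integral_add (Continuous.intervalIntegrable (by fun_prop) _ _)
      (Continuous.intervalIntegrable (by fun_prop) _ _)]
    have hcK := mul_nonneg hc.le hK0
    have hcH := mul_nonneg hc.le hH0
    have : 0 ≤ 2 * E / c + 2 * E * (C + 2) := by positivity
    rcases le_total A₀ |x| with hx | hx
    · have := (hfar x t hx).2
      linarith
    · have hx' := abs_le.1 hx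
      have h1 := h.b_sq_le hα hc (fun x => hv x t ht) ht (hs' t ht) x
      have h2 : ∫ y in x..(x + 1), F.dissKin sqrtRenorm y t
          ≤ ∫ y in (-A)..A, F.dissKin sqrtRenorm y t :=
        integral_le_of_subinterval (by fun_prop) (fun y => F.dissKin_nonneg hα _ y t)
          (by linarith) (by linarith) (by linarith)
      have h3 : 2 * E * (C + 2 + c / (8 * E) * ∫ y in (-A)..A, F.dissHeat sqrtRenorm y t)
          = 2 * E * (C + 2) + c / 4 * ∫ y in (-A)..A, F.dissHeat sqrtRenorm y t := by
        field_simp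
        ring
      rw [h3] at h1
      linarith
  · have hrem : ∃ R₁, ∀ R ≥ R₁, ∀ t ∈ Icc 0 T,
        ∫ x in (-R)..R, cutoff R x * F.remainder sqrtRenorm x t
          ≤ (C + 2) * E / c + (∫ x in (-R)..R, cutoff R x * F.dissHeat sqrtRenorm x t) / 4 :=
      ⟨2 * A, fun R hR t ht => h.integral_remainder_le hc (fun x => hv x t ht) ht hA0 hR
        (by linarith) (hs' t ht)⟩
    have h1 := F.integral_energy_add_le hα sqrtRenorm (by positivity)
      (fun A hA => hI.integral_energy_le hK hδ hδ₁ _ hA) hrem hA0.le ⟨hT.le, le_rfl⟩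
    have h2 : 0 ≤ ∫ x in (-A)..A, F.energy sqrtRenorm x T :=
      intervalIntegral.integral_nonneg (by linarith) fun x _ => F.energy_nonneg _ x T
    linarith

end MHDFlow

/-- The integral of a nonnegative function is bounded by that of any continuous majorant. -/
theorem integral_le_integral_of_continuous_majorant {f g : ℝ → ℝ} {T : ℝ} (hT : 0 ≤ T)
    (hf : ∀ t, 0 ≤ f t) (hg : Continuous g) (hfg : ∀ t ∈ Icc 0 T, f t ≤ g t) :
    ∫ t in (0:ℝ)..T, f t ≤ ∫ t in (0:ℝ)..T, g t := by
  rw [intervalIntegral.integral_of_le hT, intervalIntegral.integral_of_le hT]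
  refine integral_mono_of_nonneg (Eventually.of_forall hf) (hg.intervalIntegrable _ _).1 ?_
  filter_upwards [ae_restrict_mem measurableSet_Ioc] with t ht
  exact hfg t ⟨ht.1.le, ht.2⟩

/-- (2.22) of the paper: the time integral of `sup_x |b|²` is bounded by a
constant depending only on `T, α, β, K, δ`. -/
theorem sup_b_sq_time_integrable (α β T K δ : ℝ) (hα : 0 ≤ α) (hβ : 0 < β) (hT : 0 < T)
    (hK : 0 < K) (hδ₀ : 0 < δ) (hδ₁ : δ ≤ 1) :
    ∃ C : ℝ, 0 < C ∧
      ∀ (v u θ : ℝ → ℝ → ℝ) (w b : ℝ → ℝ → ℝ × ℝ),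
        IsClassicalSolution α β T v u θ w b → Admissible K δ v u θ w b →
        (∫ t in (0:ℝ)..T, ⨆ x : ℝ, sq2 (b x t)) ≤ C := by
  set E := 2 * ((1 / δ + 1 + 2 * K) * K ^ 2 + 2 * T) with hE
  have hE0 : 0 < E := by positivity
  set c : ℝ := MHDFlow.volumeLower α E K δ T
  have hc : 0 < c := MHDFlow.volumeLower_pos α E K δ T
  obtain ⟨C, hC, hsqrt⟩ := MHDFlow.exists_sqrt_θ_le hβ hE0 (by positivity : 0 < c / (8 * E))
  set B := 2 * E / c + 2 * E * (C + 2) + 1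
  have hB : 0 < B := by positivity
  set G := 4 * ((1 / δ + 1 + 2 * K) * K ^ 2 + ((C + 2) * E / c + 2) * T)
  have hG : 0 < G := by positivity
  refine ⟨B * T + (c / 4 + 1) * G, by positivity, fun v u θ w b h ha => ?_⟩
  have hI := h.toFlow_initBound hT hK ha
  have hL : (h.toFlow hT).LocalBound E := hI.localBound hα hT hK hδ₀ hδ₁
  obtain ⟨D, hD, hbD, hDG⟩ := hL.exists_b_sq_le hα hT hI hK hδ₀ hδ₁ hc
    (fun x t ht => hL.volumeLower_le hI hα hδ₀ x ht) hC (hsqrt α T _ hL)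
  have h1 : ∫ t in (0:ℝ)..T, ⨆ x : ℝ, sq2 (b x t)
      ≤ ∫ t in (0:ℝ)..T, (B + (c / 4 + 1) * D t) := by
    refine integral_le_integral_of_continuous_majorant hT.le (fun t => ?_) (by fun_prop)
      fun t ht => ciSup_le fun x => ?_
    · exact Real.iSup_nonneg fun x => add_nonneg (sq_nonneg _) (sq_nonneg _)
    · have := hbD x t ht
      simp only [IsClassicalSolution.toFlow, max_min_eq_self ht] at this
      exact this
  rw [intervalIntegral.integral_add (by simp)
    (Continuous.intervalIntegrable (by fun_prop) _ _), intervalIntegral.integral_const,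
    intervalIntegral.integral_const_mul, sub_zero, smul_eq_mul, mul_comm T] at h1
  have h2 := mul_le_mul_of_nonneg_left hDG (by positivity : 0 ≤ c / 4 + 1)
  linarith
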